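/- (Belkale's theorem.) Let 𝐈 ∈ Subsets(r,n,s). The following assertions are equivalent: (1) 𝐈 is intersecting; (2) edim 𝐈 ≥ 0 and for all d ∈ [r−1] and all 𝐉 ∈ Intersecting(d,r,s), edim(𝐈𝐉) ≥ edim 𝐉; (3) edim 𝐈 ≥ 0 and for all d ∈ [r−1] and all 𝐉 ∈ Intersecting^0(d,r,s), edim(𝐈𝐉) ≥ edim 𝐉. -/

import Mathlib

open Module

noncomputable section

/-- A complete flag on `ℂ^m`: an increasing family of subspaces with
`dim (F i) = i + 1` (`0`-based indexing, so `F i` is the `i+1`-st step). -/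
structure Flagg (m : ℕ) where
  F : Fin m → Submodule ℂ (Fin m → ℂ)
  mono : Monotone F
  rank_eq : ∀ i : Fin m, finrank ℂ (F i) = (i : ℕ) + 1

/-- An `s`-tuple `J` of (strictly increasing) maps `[d] → [r]` is *intersecting* if
for every `s`-tuple of complete flags on `ℂ^r` the corresponding intersection of
Schubert varieties in the Grassmannian `Gr(d, ℂ^r)` is nonempty. -/
def Intersecting {s d r : ℕ} (J : Fin s → Fin d → Fin r) : Prop :=
  ∀ F : Fin s → Flagg r, ∃ V : Submodule ℂ (Fin r → ℂ), finrank ℂ V = d ∧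
    ∀ (l : Fin s) (k : Fin d), (k : ℕ) + 1 ≤ finrank ℂ ↥(V ⊓ (F l).F (J l k))

/-- `dim I = ∑_j (I(j) - j)`. -/
def dimI {d r : ℕ} (J : Fin d → Fin r) : ℤ := ∑ k, ((J k : ℤ) - (k : ℤ))

/-- Expected dimension of a tuple `J ∈ Subsets(d,r,s)`. -/
def edim {s d r : ℕ} (J : Fin s → Fin d → Fin r) : ℤ :=
  (d : ℤ) * ((r : ℤ) - (d : ℤ)) - ∑ l, ((d : ℤ) * ((r : ℤ) - (d : ℤ)) - dimI (J l))

/-- `dim` for raw `ℕ`-valued increasing sequences. -/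
def dimN {d : ℕ} (f : Fin d → ℕ) : ℤ := ∑ k, ((f k : ℤ) - (k : ℤ))

/-- Expected dimension for raw `ℕ`-valued tuples, with ambient dimension `n` explicit. -/
def edimN {s d : ℕ} (n : ℕ) (f : Fin s → Fin d → ℕ) : ℤ :=
  (d : ℤ) * ((n : ℤ) - (d : ℤ)) - ∑ l, ((d : ℤ) * ((n : ℤ) - (d : ℤ)) - dimN (f l))

/-- `T(Λ) = ∑_l ∑_j Λ_l(j)`. -/
def TT {s r : ℕ} (Λ : Fin s → Fin r → ℝ) : ℝ := ∑ l, ∑ j, Λ l j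

/-- `T_J(Λ) = ∑_l ∑_{j ∈ J_l} Λ_l(j)`. -/
def TJ {s d r : ℕ} (J : Fin s → Fin d → Fin r) (Λ : Fin s → Fin r → ℝ) : ℝ :=
  ∑ l, ∑ k, Λ l (J l k)

/-- `Γ(J)_l(k) = k - J_l(k) + (r - d)`, a weakly decreasing real `d`-tuple. -/
def GammaT {s d r : ℕ} (J : Fin s → Fin d → Fin r) : Fin s → Fin d → ℝ :=
  fun l k => (k : ℝ) - (J l k : ℝ) + ((r : ℝ) - (d : ℝ))

/-- Membership of `(Λ, t)` in the Kirwan cone `𝒦(r,s)`: each `Λ_l` is weakly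
decreasing and there are Hermitian matrices `A_1, …, A_s` summing to `t·I_r`
whose decreasingly-ordered spectra are the `Λ_l`. -/
def KirwanMem {s r : ℕ} (Λ : Fin s → Fin r → ℝ) (t : ℝ) : Prop :=
  (∀ l, Antitone (Λ l)) ∧
  ∃ (A : Fin s → Matrix (Fin r) (Fin r) ℂ) (hA : ∀ l, (A l).IsHermitian),
    (∑ l, A l) = (t : ℂ) • (1 : Matrix (Fin r) (Fin r) ℂ) ∧
    ∀ l, ∃ e : Equiv.Perm (Fin r), ∀ i, Λ l i = (hA l).eigenvalues (e i)

/-- The subspace of a flag with `k` elements (so `flagAt G 0 = ⊥`). -/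
def flagAt {m : ℕ} (G : Flagg m) : ℕ → Submodule ℂ (Fin m → ℂ)
  | 0 => ⊥
  | (k + 1) => if h : k < m then G.F ⟨k, h⟩ else ⊤

/-- The space `ℒ_I(F,G)` of linear maps `φ : ℂ^r → ℂ^q` with
`φ(F_l(j)) ⊆ G_l(I_l(j) - j)` for all `l, j`. -/
def LSpace {s r q : ℕ} (I : Fin s → Fin r → ℕ) (F : Fin s → Flagg r) (G : Fin s → Flagg q) :
    Submodule ℂ ((Fin r → ℂ) →ₗ[ℂ] (Fin q → ℂ)) where
  carrier := {φ | ∀ (l : Fin s) (j : Fin r), ∀ v ∈ (F l).F j,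
    φ v ∈ flagAt (G l) (I l j - (j : ℕ))}
  add_mem' := by
    intro a b ha hb l j v hv
    simpa using add_mem (ha l j v hv) (hb l j v hv)
  zero_mem' := by
    intro l j v hv
    simp
  smul_mem' := by
    intro c a ha l j v hv
    simpa using Submodule.smul_mem _ c (ha l j v hv)

/-- The true dimension `tdim I`, for a raw tuple `I ∈ Subsets(r, r + q, s)`
(here `q = n - r`). -/
def tdim {s : ℕ} (r q : ℕ) (I : Fin s → Fin r → ℕ) : ℕ :=
  sInf {m : ℕ | ∃ (F : Fin s → Flagg r) (G : Fin s → Flagg q), finrank ℂ (LSpace I F G) = m}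

/-- The kernel dimension `kdim I`. -/
def kdim {s : ℕ} (r q : ℕ) (I : Fin s → Fin r → ℕ) : ℕ :=
  sInf {m : ℕ | ∃ (F : Fin s → Flagg r) (G : Fin s → Flagg q)
      (φ : (Fin r → ℂ) →ₗ[ℂ] (Fin q → ℂ)), φ ∈ LSpace I F G ∧
      finrank ℂ (LSpace I F G) = tdim r q I ∧ finrank ℂ (LinearMap.ker φ) = m}

/-- The (`0`-based) Schubert position of a subspace `W` w.r.t. a flag:
`posN Fl W k` is the least `j` with `dim (Fl(j) ⊓ W) = k + 1`. -/
def posN {m : ℕ} (Fl : Flagg m) (W : Submodule ℂ (Fin m → ℂ)) (k : ℕ) : ℕ :=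
  sInf {j : ℕ | ∃ h : j < m, finrank ℂ ↥(Fl.F ⟨j, h⟩ ⊓ W) = k + 1}

/-- The (`0`-based, `ℕ`-valued) kernel position `kPos(I)_l(k)`. -/
def kPosFun {s : ℕ} (r q : ℕ) (I : Fin s → Fin r → ℕ) (l : Fin s) (k : ℕ) : ℕ :=
  sInf {p : ℕ | ∃ (F : Fin s → Flagg r) (G : Fin s → Flagg q)
      (φ : (Fin r → ℂ) →ₗ[ℂ] (Fin q → ℂ)), φ ∈ LSpace I F G ∧
      finrank ℂ (LSpace I F G) = tdim r q I ∧
      finrank ℂ (LinearMap.ker φ) = kdim r q I ∧ posN (F l) (LinearMap.ker φ) k = p}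

/-- Apply an `r`-tuple of reals at a natural index (junk value `0` out of range). -/
def applyI {r : ℕ} (f : Fin r → ℝ) (j : ℕ) : ℝ := if h : j < r then f ⟨j, h⟩ else 0

/-- Apply an `r`-tuple of naturals at a natural index (junk value `0` out of range). -/
def applyN {r : ℕ} (f : Fin r → ℕ) (j : ℕ) : ℕ := if h : j < r then f ⟨j, h⟩ else 0

/-- The slope `slope_θ(J) = (1/d) ∑_l ∑_{j ∈ J_l} θ_l(j)` of a tuple. -/
def slopeT {s d r : ℕ} (θ : Fin s → Fin r → ℝ) (J : Fin s → Fin d → Fin r) : ℝ :=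
  ((d : ℝ))⁻¹ * ∑ l, ∑ k, θ l (J l k)

/-- The slope `slope_θ(W, F) = slope_θ(Pos(W, F))` of a (nonzero) subspace. -/
def slopeW {s r : ℕ} (θ : Fin s → Fin r → ℝ) (F : Fin s → Flagg r)
    (W : Submodule ℂ (Fin r → ℂ)) : ℝ :=
  ((finrank ℂ W : ℝ))⁻¹ * ∑ l, ∑ k ∈ Finset.range (finrank ℂ W), applyI (θ l) (posN (F l) W k)

end
/-! ### Linear families -/

theorem finite_det_zero {ι : Type*} [Fintype ι] [DecidableEq ι] (U : Matrix ι ι ℂ) :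
    {t : ℂ | (1 + t • U).det = 0}.Finite := by
  let p : Polynomial ℂ := (1 + (Polynomial.X : Polynomial ℂ) • U.map Polynomial.C).det
  have hp : ∀ t, p.eval t = (1 + t • U).det := by
    intro t
    have := (Polynomial.evalRingHom t).map_det (1 + (Polynomial.X : Polynomial ℂ) • U.map Polynomial.C)
    simp only [Polynomial.coe_evalRingHom] at this
    rw [this]
    congr 1
    ext i j
    simp [Matrix.one_apply]
    split_ifs <;> simp [mul_comm]
  have hne : p ≠ 0 := by
    intro h
    have := hp 0
    rw [h] at this
    simp at this
  refine (p.roots.toFinset.finite_toSet).subset ?_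
  intro t ht
  simp only [Finset.mem_coe, Multiset.mem_toFinset]
  rw [Polynomial.mem_roots hne, Polynomial.IsRoot, hp t]
  exact ht

theorem lin0 {ι F : Type*} [Finite ι] [AddCommGroup F] [Module ℂ F] (w u : ι → F)
    (hw : LinearIndependent ℂ w) :
    {t : ℂ | ¬ LinearIndependent ℂ (fun i => w i + t • u i)}.Finite := by
  classical
  have := Fintype.ofFinite ι
  obtain ⟨π, hπ⟩ : ∃ π : F →ₗ[ℂ] (ι → ℂ), ∀ i, π (w i) = Pi.single i 1 := by
    obtain ⟨g, hg⟩ := LinearMap.exists_extend ((Finsupp.linearEquivFunOnFinite ℂ ℂ ι).toLinearMap ∘ₗ hw.repr)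
    refine ⟨g, fun i => ?_⟩
    have h1 : w i ∈ Submodule.span ℂ (Set.range w) := Submodule.subset_span ⟨i, rfl⟩
    have := LinearMap.congr_fun hg ⟨w i, h1⟩
    simp only [LinearMap.comp_apply, Submodule.subtype_apply] at this
    rw [this, hw.repr_eq_single i ⟨w i, h1⟩ rfl]
    simp
  refine (finite_det_zero (Matrix.of fun i => π (u i))).subset ?_
  intro t ht
  by_contra hdet
  apply ht
  have h2 : LinearIndependent ℂ (fun i => π (w i + t • u i)) := by
    have h3 := Matrix.linearIndependent_rows_of_det_ne_zero hdet
    have e : (fun i => π (w i + t • u i)) = fun i => (1 + t • Matrix.of fun i => π (u i)) i := by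
      funext i
      ext j
      simp [hπ, Matrix.one_apply, Pi.single_apply, eq_comm]
    rw [e]
    exact h3
  exact LinearIndependent.of_comp π h2

theorem exists_indep_lift {E F : Type*} [AddCommGroup E] [Module ℂ E] [AddCommGroup F] [Module ℂ F]
    [FiniteDimensional ℂ F] (L : E →ₗ[ℂ] F) :
    ∃ v : Fin (finrank ℂ (LinearMap.range L)) → E, LinearIndependent ℂ (fun i => L (v i)) := by
  let b := finBasis ℂ (LinearMap.range L)
  choose v hv using fun i => (b i).2
  refine ⟨v, ?_⟩
  have h := b.linearIndependent.map' (LinearMap.range L).subtype (Submodule.ker_subtype _)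
  have e : (fun i => L (v i)) = (LinearMap.range L).subtype ∘ b := by
    funext i
    simp [hv]
  rw [e]
  exact h

theorem rank_ge_of_indep {E F ι : Type*} [Fintype ι] [AddCommGroup E] [Module ℂ E] [AddCommGroup F]
    [Module ℂ F] [FiniteDimensional ℂ F] (L : E →ₗ[ℂ] F) (v : ι → F) (hv : LinearIndependent ℂ v)
    (h : ∀ i, v i ∈ LinearMap.range L) : Fintype.card ι ≤ finrank ℂ (LinearMap.range L) := by
  have h1 : LinearIndependent ℂ (fun i => (⟨v i, h i⟩ : LinearMap.range L)) :=
    LinearIndependent.of_comp (LinearMap.range L).subtype hv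
  exact h1.fintype_card_le_finrank

theorem lin1 {E F : Type*} [AddCommGroup E] [Module ℂ E] [AddCommGroup F] [Module ℂ F]
    [FiniteDimensional ℂ F] (L0 L1 : E →ₗ[ℂ] F) :
    {t : ℂ | ¬ finrank ℂ (LinearMap.range L0) ≤ finrank ℂ (LinearMap.range (L0 + t • L1))}.Finite := by
  obtain ⟨v, hv⟩ := exists_indep_lift L0
  refine (lin0 _ (fun i => L1 (v i)) hv).subset ?_
  intro t ht hind
  apply ht
  have := rank_ge_of_indep (L0 + t • L1) _ hind (fun i => ⟨v i, by simp⟩)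
  simpa using this

theorem lin2 {E F : Type*} [AddCommGroup E] [Module ℂ E] [AddCommGroup F] [Module ℂ F]
    [FiniteDimensional ℂ F] (L0 L1 : E →ₗ[ℂ] F)
    (h : ∀ t : ℂ, finrank ℂ (LinearMap.range (L0 + t • L1)) ≤ finrank ℂ (LinearMap.range L0))
    (x : E) (hx : L0 x = 0) : L1 x ∈ LinearMap.range L0 := by
  by_contra hcon
  obtain ⟨v, hv⟩ := exists_indep_lift L0
  let w : Option (Fin (finrank ℂ (LinearMap.range L0))) → F := fun o => o.elim (L1 x) (fun i => L0 (v i))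
  let u : Option (Fin (finrank ℂ (LinearMap.range L0))) → F := fun o => o.elim 0 (fun i => L1 (v i))
  have hw : LinearIndependent ℂ w := by
    rw [linearIndependent_option]
    refine ⟨hv, ?_⟩
    intro hmem
    apply hcon
    refine (Submodule.span_le.2 ?_) hmem
    rintro _ ⟨i, rfl⟩
    exact ⟨v i, rfl⟩
  have hfin := (lin0 w u hw).union (Set.finite_singleton (0 : ℂ))
  obtain ⟨t, ht⟩ := hfin.infinite_compl.nonempty
  simp only [Set.mem_compl_iff, Set.mem_union, Set.mem_ofPred_eq, not_or, not_not, Set.mem_singleton_iff] at ht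
  have := rank_ge_of_indep (L0 + t • L1) _ ht.1 (by
    rintro (_ | i)
    · refine ⟨t⁻¹ • x, ?_⟩
      simp [w, u, hx, smul_smul, ht.2]
    · exact ⟨v i, by simp [w, u]⟩)
  simp only [Fintype.card_option, Fintype.card_fin] at this
  have := h t
  omega

/-- A predicate that, once true at a point, is true at all but finitely many points of every
complex line through it. -/
def LineOpen {E : Type*} [AddCommGroup E] [Module ℂ E] (P : E → Prop) : Prop :=
  ∀ x, P x → ∀ y, {t : ℂ | ¬ P (x + t • y)}.Finite

section lineopen
variable {E : Type*} [AddCommGroup E] [Module ℂ E]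

theorem LineOpen.and {P Q : E → Prop} (hP : LineOpen P) (hQ : LineOpen Q) :
    LineOpen (fun x => P x ∧ Q x) := by
  intro x hx y
  refine ((hP x hx.1 y).union (hQ x hx.2 y)).subset ?_
  intro t ht
  simp only [Set.mem_ofPred_eq, Set.mem_union] at ht ⊢
  tauto

theorem LineOpen.forall_fin {ι : Type*} [Finite ι] {P : ι → E → Prop} (hP : ∀ i, LineOpen (P i)) :
    LineOpen (fun x => ∀ i, P i x) := by
  intro x hx y
  refine (Set.finite_iUnion (fun i => hP i x (hx i) y)).subset ?_
  intro t ht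
  simp only [Set.mem_ofPred_eq, not_forall, Set.mem_iUnion] at ht ⊢
  exact ht

theorem LineOpen.exists_and {P Q : E → Prop} (hP : LineOpen P) (hQ : LineOpen Q)
    (h1 : ∃ x, P x) (h2 : ∃ x, Q x) : ∃ x, P x ∧ Q x := by
  obtain ⟨x, hx⟩ := h1
  obtain ⟨z, hz⟩ := h2
  have f1 := hP x hx (z - x)
  have f2 := hQ z hz (x - z)
  have f3 : {t : ℂ | ¬ Q (x + t • (z - x))}.Finite := by
    refine (f2.image (fun t => 1 - t)).subset ?_
    intro t ht
    refine ⟨1 - t, ?_, by ring⟩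
    simp only [Set.mem_ofPred_eq] at ht ⊢
    convert ht using 2
    module
  obtain ⟨t, ht⟩ := (f1.union f3).infinite_compl.nonempty
  simp only [Set.mem_compl_iff, Set.mem_union, Set.mem_ofPred_eq, not_or, not_not] at ht
  exact ⟨_, ht⟩

theorem LineOpen.exists_forall_finset {ι : Type*} {P : ι → E → Prop} (hP : ∀ i, LineOpen (P i))
    (h : ∀ i, ∃ x, P i x) (A : Finset ι) : ∃ x, ∀ i ∈ A, P i x := by
  classical
  induction A using Finset.induction_on with
  | empty => exact ⟨0, by simp⟩
  | insert a A ha ih =>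
    have hL : LineOpen (fun x => ∀ i ∈ A, P i x) := by
      have := LineOpen.forall_fin (ι := A) (P := fun i => P i) (fun i => hP i)
      intro x hx y
      have := this x (fun i => hx i i.2) y
      refine this.subset ?_
      intro t ht h'
      exact ht (fun i hi => h' ⟨i, hi⟩)
    obtain ⟨x, h1, h2⟩ := LineOpen.exists_and (hP a) hL (h a) ih
    exact ⟨x, by simpa using ⟨h1, h2⟩⟩

theorem LineOpen.exists_forall {ι : Type*} [Finite ι] {P : ι → E → Prop} (hP : ∀ i, LineOpen (P i))
    (h : ∀ i, ∃ x, P i x) : ∃ x, ∀ i, P i x := by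
  have := Fintype.ofFinite ι
  obtain ⟨x, hx⟩ := LineOpen.exists_forall_finset hP h Finset.univ
  exact ⟨x, fun i => hx i (Finset.mem_univ i)⟩

end lineopen

/-! ### Generic solvability of polynomial systems in one parameter -/

theorem extend_hom {R B : Type*} [CommRing R] [CommRing B] [Algebra R B] [Algebra.IsIntegral R B]
    (hinj : Function.Injective (algebraMap R B)) (ψ : R →+* ℂ) :
    ∃ ρ : B →+* ℂ, ∀ r, ρ (algebraMap R B r) = ψ r := by
  have hp : (RingHom.ker ψ).IsPrime := RingHom.ker_isPrime ψ
  obtain ⟨Q, -, hQ, hQc⟩ := Ideal.exists_ideal_over_prime_of_isIntegral (RingHom.ker ψ) (⊥ : Ideal B)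
    (by rw [Ideal.comap_bot_of_injective _ hinj]; exact bot_le)
  let R' := R ⧸ RingHom.ker ψ
  let ψ' : R' →+* ℂ := RingHom.kerLift ψ
  have hψ' : Function.Injective ψ' := RingHom.kerLift_injective ψ
  have : Q.LiesOver (RingHom.ker ψ) := ⟨hQc.symm⟩
  let _ : Algebra R' ℂ := ψ'.toAlgebra
  have : Algebra.IsIntegral R' (B ⧸ Q) := inferInstance
  have hf : FaithfulSMul R' ℂ := (faithfulSMul_iff_algebraMap_injective R' ℂ).2 hψ'
  have hf2 : FaithfulSMul R' (B ⧸ Q) := inferInstance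
  have : Algebra.IsAlgebraic R' (B ⧸ Q) := Algebra.IsIntegral.isAlgebraic
  have d1 : IsDomain R' := Ideal.Quotient.isDomain _
  have d2 : IsDomain (B ⧸ Q) := Ideal.Quotient.isDomain _
  have t1 : Module.IsTorsionFree R' (B ⧸ Q) := FaithfulSMul.to_isTorsionFree R' (B ⧸ Q)
  have t2 : Module.IsTorsionFree R' ℂ := FaithfulSMul.to_isTorsionFree R' ℂ
  let lam : (B ⧸ Q) →ₐ[R'] ℂ := IsAlgClosed.lift
  refine ⟨lam.toRingHom.comp (Ideal.Quotient.mk Q), fun r => ?_⟩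
  have h1 := lam.commutes (Ideal.Quotient.mk _ r)
  exact h1

attribute [local instance] MvPolynomial.algebraMvPolynomial in
theorem gen_dichotomy {τ : Type} [Finite τ] (P : Set (MvPolynomial τ (Polynomial ℂ))) :
    let K := {t : ℂ | ∃ x : τ → ℂ, ∀ p ∈ P, MvPolynomial.eval₂ (Polynomial.evalRingHom t) x p = 0}
    K.Finite ∨ Kᶜ.Finite := by
  intro K
  let A := Polynomial ℂ
  let L := FractionRing A
  let mp : MvPolynomial τ A →+* MvPolynomial τ L := MvPolynomial.map (algebraMap A L)
  have fin_roots : ∀ a : A, a ≠ 0 → {t : ℂ | a.eval t = 0}.Finite := by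
    intro a ha
    refine (a.roots.toFinset.finite_toSet).subset ?_
    intro t ht
    simpa [Polynomial.mem_roots ha] using ht
  by_cases htop : (Ideal.span P).map mp = ⊤
  · left
    have hloc := MvPolynomial.isLocalization (σ := τ) (nonZeroDivisors A) L
    have halg : algebraMap (MvPolynomial τ A) (MvPolynomial τ L) = mp := rfl
    have hnd : ¬ Disjoint (((nonZeroDivisors A).map (MvPolynomial.C (σ := τ)) : Submonoid _) :
        Set (MvPolynomial τ A)) (Ideal.span P : Ideal (MvPolynomial τ A)) := by
      intro hd
      have := (IsLocalization.map_algebraMap_ne_top_iff_disjoint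
        ((nonZeroDivisors A).map (MvPolynomial.C (σ := τ))) (MvPolynomial τ L) (Ideal.span P)).2 hd
      exact this (by rw [halg]; exact htop)
    rw [Set.not_disjoint_iff] at hnd
    obtain ⟨_, ⟨a, ha, rfl⟩, ha2⟩ := hnd
    have ha0 : a ≠ 0 := nonZeroDivisors.ne_zero ha
    refine (fin_roots a ha0).subset ?_
    rintro t ⟨x, hx⟩
    have hle : Ideal.span P ≤ RingHom.ker (MvPolynomial.eval₂Hom (Polynomial.evalRingHom t) x) :=
      Ideal.span_le.2 (fun p hp => hx p hp)
    have := hle ha2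
    rw [RingHom.mem_ker] at this
    simpa using this
  · right
    obtain ⟨m, hm, hle⟩ := Ideal.exists_le_maximal _ htop
    let κ := MvPolynomial τ L ⧸ m
    let _ : Field κ := Ideal.Quotient.field m
    have hfin : Module.Finite L κ := by
      have : Algebra.FiniteType L κ := inferInstance
      exact finite_of_finite_type_of_isJacobsonRing L κ
    have halg : Algebra.IsAlgebraic L κ := inferInstance
    have halgA : Algebra.IsAlgebraic A κ := (IsFractionRing.comap_isAlgebraic_iff (A := A) (K := L) (C := κ)).2 halg
    let xx : τ → κ := fun i => Ideal.Quotient.mk m (MvPolynomial.X i)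
    choose a ha hintegral using fun i => (halgA.isAlgebraic (xx i)).exists_integral_multiple
    have := Fintype.ofFinite τ
    let aa : A := ∏ i, a i
    have haa : aa ≠ 0 := Finset.prod_ne_zero_iff.2 (fun i _ => ha i)
    refine (fin_roots aa haa).subset ?_
    intro t ht
    by_contra hne
    apply ht
    let R := Localization.Away aa
    have hAκ : Function.Injective (algebraMap A κ) := by
      rw [IsScalarTower.algebraMap_eq A L κ]
      exact (algebraMap L κ).injective.comp (IsFractionRing.injective A L)
    have hu : IsUnit (algebraMap A κ aa) := by
      refine IsUnit.mk0 _ ?_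
      intro h0
      exact haa (hAκ (by rw [h0, map_zero]))
    let jj : R →+* κ := IsLocalization.Away.lift aa hu
    have hjj : ∀ c, jj (algebraMap A R c) = algebraMap A κ c := fun c => IsLocalization.Away.lift_eq aa hu c
    let _ : Algebra R κ := jj.toAlgebra
    have htow : IsScalarTower A R κ := IsScalarTower.of_algebraMap_eq (fun c => (hjj c).symm)
    have hjinj : Function.Injective jj := by
      rw [injective_iff_map_eq_zero]
      intro z hz
      obtain ⟨n, c, hc⟩ := IsLocalization.Away.surj aa z
      have h1 : jj z * jj (algebraMap A R aa) ^ n = jj (algebraMap A R c) := by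
        rw [← hc, map_mul, map_pow]
      rw [hz, zero_mul, hjj] at h1
      have hc0 : c = 0 := hAκ (by rw [← h1, map_zero])
      rw [hc0, map_zero] at hc
      have hunit : IsUnit (algebraMap A R aa ^ n) := (IsLocalization.Away.algebraMap_isUnit aa).pow n
      exact (hunit.mul_left_eq_zero).1 hc
    have hxint : ∀ i, IsIntegral R (xx i) := by
      intro i
      have h1 : IsIntegral R (a i • xx i) := (hintegral i).tower_top
      have hai : IsUnit (algebraMap A R (a i)) := by
        have h2 : IsUnit (algebraMap A R aa) := IsLocalization.Away.algebraMap_isUnit aa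
        exact isUnit_of_dvd_unit (map_dvd _ (Finset.dvd_prod_of_mem a (Finset.mem_univ i))) h2
      obtain ⟨u, hu2⟩ := hai
      have h3 : xx i = ((u⁻¹ : Rˣ) : R) • (a i • xx i) := by
        rw [← IsScalarTower.algebraMap_smul R (a i) (xx i), ← hu2, smul_smul]
        simp
      rw [h3]
      exact h1.smul _
    let B := integralClosure R κ
    have hBinj : Function.Injective (algebraMap R B) := by
      intro p q hpq
      apply hjinj
      exact congrArg (fun z : B => (z : κ)) hpq
    have htu : IsUnit (Polynomial.evalRingHom t aa) := IsUnit.mk0 _ hne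
    let ψ : R →+* ℂ := IsLocalization.Away.lift aa htu
    obtain ⟨ρ, hρ⟩ := extend_hom hBinj ψ
    let xb : τ → B := fun i => ⟨xx i, hxint i⟩
    refine ⟨fun i => ρ (xb i), fun p hp => ?_⟩
    have e1 : ρ.comp ((algebraMap R B).comp (algebraMap A R)) = Polynomial.evalRingHom t := by
      ext c
      · simp only [RingHom.comp_apply]
        rw [hρ]
        exact IsLocalization.Away.lift_eq aa htu _
      · simp only [RingHom.comp_apply]
        rw [hρ]
        exact IsLocalization.Away.lift_eq aa htu _
    rw [← e1]
    have e2 := MvPolynomial.eval₂_comp_left ρ ((algebraMap R B).comp (algebraMap A R)) xb p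
    have e3 : MvPolynomial.eval₂ ((algebraMap R B).comp (algebraMap A R)) xb p = 0 := by
      apply Subtype.ext
      have e4 := MvPolynomial.eval₂_comp_left (algebraMap B κ) ((algebraMap R B).comp (algebraMap A R)) xb p
      have e5 : (algebraMap B κ).comp ((algebraMap R B).comp (algebraMap A R)) =
          (Ideal.Quotient.mk m).comp (MvPolynomial.C.comp (algebraMap A L)) := by
        refine RingHom.ext fun c => ?_
        exact hjj c
      change algebraMap B κ _ = 0
      rw [e4, e5]
      have e6 := MvPolynomial.eval₂_comp_left (Ideal.Quotient.mk m) (MvPolynomial.C.comp (algebraMap A L)) MvPolynomial.X p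
      have e7 : (algebraMap B κ) ∘ xb = (Ideal.Quotient.mk m) ∘ MvPolynomial.X := rfl
      rw [e7, ← e6]
      have e8 : MvPolynomial.eval₂ (MvPolynomial.C.comp (algebraMap A L)) MvPolynomial.X p = mp p := by
        have : (MvPolynomial.eval₂Hom (MvPolynomial.C.comp (algebraMap A L)) MvPolynomial.X :
            MvPolynomial τ A →+* MvPolynomial τ L) = mp := by
          apply MvPolynomial.ringHom_ext
          · intro c; simp [mp]
          · intro c; simp [mp]
        exact congrArg (fun h => h p) this
      rw [e8, Ideal.Quotient.eq_zero_iff_mem]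
      exact hle (Ideal.mem_map_of_mem _ (Ideal.subset_span hp))
    rw [e3, map_zero] at e2
    exact e2.symm

/-! ### Frames, flags and positions -/

/-- The subspace spanned by the first `j+1` vectors of `f`. -/
def Fsp {m : ℕ} {E : Type*} [AddCommGroup E] [Module ℂ E] (f : Fin m → E) (j : Fin m) :
    Submodule ℂ E := Submodule.span ℂ (f '' Set.Iic j)

/-- A tuple of bases. -/
def Frame {s m : ℕ} (f : Fin s → Fin m → Fin m → ℂ) : Prop := ∀ l, LinearIndependent ℂ (f l)

def Zp {s d r : ℕ} (J : Fin s → Fin d → Fin r) (f : Fin s → Fin r → Fin r → ℂ) : Prop :=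
  ∃ V : Submodule ℂ (Fin r → ℂ), finrank ℂ V = d ∧
    ∀ (l : Fin s) (k : Fin d), (k : ℕ) + 1 ≤ finrank ℂ ↥(V ⊓ Fsp (f l) (J l k))

theorem Fsp_mono {m : ℕ} {E : Type*} [AddCommGroup E] [Module ℂ E] (f : Fin m → E) :
    Monotone (Fsp f) := fun _ _ h => Submodule.span_mono (Set.image_mono (Set.Iic_subset_Iic.2 h))

theorem mem_Fsp {m : ℕ} {E : Type*} [AddCommGroup E] [Module ℂ E] (f : Fin m → E) {i j : Fin m}
    (h : i ≤ j) : f i ∈ Fsp f j := Submodule.subset_span ⟨i, h, rfl⟩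

theorem finrank_span_image {ι : Type*} {E : Type*} [AddCommGroup E] [Module ℂ E]
    {f : ι → E} (hf : LinearIndependent ℂ f) (A : Finset ι) :
    finrank ℂ (Submodule.span ℂ (f '' (A : Set ι))) = A.card := by
  have h1 : LinearIndependent ℂ (fun i : A => f i) := hf.comp _ Subtype.val_injective
  have := finrank_span_eq_card h1
  rw [Fintype.card_coe] at this
  rw [← this, Set.image_eq_range]
  rfl

theorem Fsp_finrank {m : ℕ} {E : Type*} [AddCommGroup E] [Module ℂ E] {f : Fin m → E}
    (hf : LinearIndependent ℂ f) (j : Fin m) : finrank ℂ (Fsp f j) = j + 1 := by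
  have := finrank_span_image hf (Finset.Iic j)
  rw [Finset.coe_Iic] at this
  unfold Fsp
  rw [this, Fin.card_Iic]

theorem indep_of_notMem {m : ℕ} {E : Type*} [AddCommGroup E] [Module ℂ E] (f : Fin m → E)
    (h : ∀ j, f j ∉ Submodule.span ℂ (f '' Set.Iio j)) : LinearIndependent ℂ f := by
  induction m with
  | zero => exact linearIndependent_empty_type
  | succ m ih =>
    rw [linearIndependent_finSucc']
    refine ⟨ih _ ?_, ?_⟩
    · intro j hj
      apply h j.castSucc
      refine Submodule.span_mono ?_ hj
      rintro _ ⟨i, hi, rfl⟩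
      exact ⟨i.castSucc, by simpa using hi, rfl⟩
    · intro hj
      apply h (Fin.last m)
      refine Submodule.span_mono ?_ hj
      rintro _ ⟨i, rfl⟩
      exact ⟨i.castSucc, by simp [Fin.castSucc_lt_last], rfl⟩

theorem indep_notMem {m : ℕ} {E : Type*} [AddCommGroup E] [Module ℂ E] {f : Fin m → E}
    (hf : LinearIndependent ℂ f) (j : Fin m) : f j ∉ Submodule.span ℂ (f '' Set.Iio j) :=
  hf.notMem_span_image (by simp)

theorem flagAt_finrank {m : ℕ} (G : Flagg m) (k : ℕ) (hk : k ≤ m) : finrank ℂ (flagAt G k) = k := by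
  cases k with
  | zero => exact finrank_bot ℂ _
  | succ k =>
    have h : k < m := by omega
    have e : flagAt G (k + 1) = G.F ⟨k, h⟩ := by simp only [flagAt, h, dite_true]
    rw [e, G.rank_eq]

theorem le_flagAt {m : ℕ} (G : Flagg m) (k : ℕ) (i : Fin m) (hi : (i : ℕ) < k) (hk : k ≤ m) :
    G.F i ≤ flagAt G k := by
  cases k with
  | zero => omega
  | succ k =>
    simp only [flagAt, show k < m by omega, dite_true]
    exact G.mono (by rw [Fin.le_def]; simp; omega)

theorem frame_of_flag {m : ℕ} (G : Flagg m) :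
    ∃ f : Fin m → Fin m → ℂ, LinearIndependent ℂ f ∧ ∀ j, Fsp f j = G.F j := by
  have h1 : ∀ j : Fin m, ∃ x ∈ G.F j, x ∉ flagAt G j := by
    intro j
    by_contra hcon
    push Not at hcon
    have := Submodule.finrank_mono (show G.F j ≤ flagAt G j from hcon)
    rw [G.rank_eq, flagAt_finrank G j (by omega)] at this
    omega
  choose f hf1 hf2 using h1
  have hind : LinearIndependent ℂ f := by
    apply indep_of_notMem
    intro j hj
    apply hf2 j
    refine Submodule.span_le.2 ?_ hj
    rintro _ ⟨i, hi, rfl⟩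
    exact le_flagAt G j i hi (by omega) (hf1 i)
  refine ⟨f, hind, fun j => ?_⟩
  apply Submodule.eq_of_le_of_finrank_eq
  · refine Submodule.span_le.2 ?_
    rintro _ ⟨i, hi, rfl⟩
    exact G.mono hi (hf1 i)
  · rw [Fsp_finrank hind, G.rank_eq]

theorem intersecting_iff {s d r : ℕ} (J : Fin s → Fin d → Fin r) :
    Intersecting J ↔ ∀ f : Fin s → Fin r → Fin r → ℂ, Frame f → Zp J f := by
  constructor
  · intro h f hf
    exact h (fun l => ⟨Fsp (f l), Fsp_mono _, Fsp_finrank (hf l)⟩)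
  · intro h F
    choose f hf1 hf2 using fun l => frame_of_flag (F l)
    obtain ⟨V, hV, hV2⟩ := h f hf1
    refine ⟨V, hV, fun l k => ?_⟩
    rw [← hf2]
    exact hV2 l k

/-- Spans over lower sets only depend on the flag. -/
theorem span_lower_le {m : ℕ} {E : Type*} [AddCommGroup E] [Module ℂ E] {f b : Fin m → E}
    (h : ∀ j, b j ∈ Fsp f j) {A : Set (Fin m)} (hA : IsLowerSet A) :
    Submodule.span ℂ (b '' A) ≤ Submodule.span ℂ (f '' A) := by
  refine Submodule.span_le.2 ?_
  rintro _ ⟨i, hi, rfl⟩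
  refine Submodule.span_mono (Set.image_mono ?_) (h i)
  intro j hj
  exact hA hj hi

theorem Fsp_eq_of_mem {m : ℕ} {E : Type*} [AddCommGroup E] [Module ℂ E] {f b : Fin m → E}
    (hf : LinearIndependent ℂ f) (hb : LinearIndependent ℂ b) (h : ∀ j, b j ∈ Fsp f j) (j : Fin m) :
    Fsp b j = Fsp f j := by
  have : FiniteDimensional ℂ (Fsp f j) := FiniteDimensional.span_of_finite ℂ (Set.toFinite _)
  apply Submodule.eq_of_le_of_finrank_eq
  · exact span_lower_le h (isLowerSet_Iic j)
  · rw [Fsp_finrank hf, Fsp_finrank hb]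

theorem span_lower_eq {m : ℕ} {E : Type*} [AddCommGroup E] [Module ℂ E] {f b : Fin m → E}
    (hf : LinearIndependent ℂ f) (hb : LinearIndependent ℂ b) (h : ∀ j, b j ∈ Fsp f j)
    {A : Set (Fin m)} (hA : IsLowerSet A) :
    Submodule.span ℂ (b '' A) = Submodule.span ℂ (f '' A) := by
  apply le_antisymm (span_lower_le h hA)
  apply span_lower_le _ hA
  intro j
  rw [Fsp_eq_of_mem hf hb h]
  exact mem_Fsp f le_rfl

theorem pos_lemma {r d : ℕ} {f : Fin r → Fin r → ℂ} (hf : LinearIndependent ℂ f)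
    (S : Submodule ℂ (Fin r → ℂ)) (hd : finrank ℂ S = d) :
    ∃ b : Fin r → Fin r → ℂ, LinearIndependent ℂ b ∧ (∀ j, b j ∈ Fsp f j) ∧
      ∃ J : Fin d → Fin r, StrictMono J ∧ ∀ k, b (J k) ∈ S := by
  classical
  let P : Finset (Fin r) := Finset.univ.filter
    (fun j => ∃ v ∈ S, v ∈ Fsp f j ∧ v ∉ Submodule.span ℂ (f '' Set.Iio j))
  have h1 : ∀ j, ∃ v, (j ∈ P → v ∈ S) ∧ v ∈ Fsp f j ∧ v ∉ Submodule.span ℂ (f '' Set.Iio j) := by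
    intro j
    by_cases hj : j ∈ P
    · obtain ⟨v, h1, h2, h3⟩ := (Finset.mem_filter.1 hj).2
      exact ⟨v, fun _ => h1, h2, h3⟩
    · exact ⟨f j, fun h => absurd h hj, mem_Fsp f le_rfl, indep_notMem hf j⟩
  choose b hb1 hb2 hb3 using h1
  have hle : ∀ j, Submodule.span ℂ (b '' Set.Iio j) ≤ Submodule.span ℂ (f '' Set.Iio j) :=
    fun j => span_lower_le hb2 (isLowerSet_Iio j)
  have hb : LinearIndependent ℂ b := indep_of_notMem _ (fun j hj => hb3 j (hle j hj))
  have hspan : Submodule.span ℂ (b '' (P : Set (Fin r))) = S := by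
    apply le_antisymm
    · refine Submodule.span_le.2 ?_
      rintro _ ⟨i, hi, rfl⟩
      exact hb1 i hi
    · intro x hx
      let B := basisOfLinearIndependentOfCardEqFinrank' b hb (by simp)
      have hB : ∀ i, B i = b i := fun i => by simp [B]
      have hx1 : ∑ i, B.repr x i • b i = x := by
        have := B.sum_repr x
        simpa only [hB] using this
      let x' := ∑ i ∈ Pᶜ, B.repr x i • b i
      have hsum : x = ∑ i ∈ P, B.repr x i • b i + x' := by
        rw [Finset.sum_add_sum_compl]; exact hx1.symm
      have hmem1 : ∑ i ∈ P, B.repr x i • b i ∈ Submodule.span ℂ (b '' (P : Set (Fin r))) :=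
        Submodule.sum_mem _ (fun i hi => Submodule.smul_mem _ _ (Submodule.subset_span ⟨i, hi, rfl⟩))
      have hmem2 : ∑ i ∈ P, B.repr x i • b i ∈ S :=
        Submodule.sum_mem _ (fun i hi => Submodule.smul_mem _ _ (hb1 i hi))
      have hx' : x' ∈ S := by
        have : x' = x - ∑ i ∈ P, B.repr x i • b i := eq_sub_of_add_eq' hsum.symm
        rw [this]
        exact S.sub_mem hx hmem2
      suffices h0 : ∀ i ∈ Pᶜ, B.repr x i = 0 by
        have : x' = 0 := Finset.sum_eq_zero (fun i hi => by rw [h0 i hi, zero_smul])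
        rw [hsum, this, add_zero]
        exact hmem1
      by_contra hcon
      push Not at hcon
      let A := Pᶜ.filter (fun i => B.repr x i ≠ 0)
      have hA : A.Nonempty := by
        obtain ⟨i, hi, hi2⟩ := hcon
        exact ⟨i, Finset.mem_filter.2 ⟨hi, hi2⟩⟩
      obtain ⟨hjP, hj0⟩ := Finset.mem_filter.1 (A.max'_mem hA)
      set j := A.max' hA with hj
      have hlow : ∀ i ∈ Pᶜ.erase j, B.repr x i • b i ∈ Submodule.span ℂ (f '' Set.Iio j) := by
        intro i hi
        obtain ⟨hi1, hi2⟩ := Finset.mem_erase.1 hi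
        by_cases hz : B.repr x i = 0
        · rw [hz, zero_smul]; exact Submodule.zero_mem _
        · have : i ≤ j := A.le_max' i (Finset.mem_filter.2 ⟨hi2, hz⟩)
          refine Submodule.smul_mem _ _ (hle j (Submodule.subset_span ⟨i, lt_of_le_of_ne this hi1, rfl⟩))
      have hx'e : x' = B.repr x j • b j + ∑ i ∈ Pᶜ.erase j, B.repr x i • b i :=
        (Finset.add_sum_erase _ _ hjP).symm
      have hl := Submodule.sum_mem _ hlow
      have : j ∈ P := by
        refine Finset.mem_filter.2 ⟨Finset.mem_univ _, x', hx', ?_, ?_⟩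
        · rw [hx'e]
          refine add_mem (Submodule.smul_mem _ _ (hb2 j)) (Submodule.span_mono (Set.image_mono ?_) hl)
          exact Set.Iio_subset_Iic_self
        · intro hc
          rw [hx'e] at hc
          have h2 := (Submodule.add_mem_iff_left _ hl).1 hc
          exact hb3 j ((Submodule.smul_mem_iff _ hj0).1 h2)
      exact (Finset.mem_compl.1 hjP) this
  have hcard : P.card = d := by
    rw [← finrank_span_image hb P, hspan, hd]
  refine ⟨b, hb, hb2, P.orderEmbOfFin hcard, (P.orderEmbOfFin hcard).strictMono, fun k => ?_⟩
  exact hb1 _ (P.orderEmbOfFin_mem hcard k)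

/-! ### The incidence variety as a polynomial system -/

section sys
variable {s d r : ℕ}

/-- All equations of the incidence variety, over a general ring. -/
def sysE {R : Type} [CommRing R] (J : Fin s → Fin d → Fin r)
    (f : Fin s → Matrix (Fin r) (Fin r) R) (W : Matrix (Fin d) (Fin r) R)
    (Y : Matrix (Fin r) (Fin d) R) (U : Fin s → Fin d → Matrix (Fin d) (Fin r) R)
    (D : Fin s → Fin d → Matrix (Fin r) (Fin d) R) :
    (Fin d × Fin d) ⊕ ((Fin s × Fin d × Fin d × Fin d) ⊕
      ((Fin s × Fin d × Fin d × Fin r) ⊕ (Fin s × Fin d × Fin d × Fin r))) → R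
  | .inl (p, p') => (W * Y) p p' - (1 : Matrix (Fin d) (Fin d) R) p p'
  | .inr (.inl (l, k, p, p')) =>
      (U l k * D l k) p p' - (if p = p' ∧ p ≤ k then 1 else 0)
  | .inr (.inr (.inl (l, k, p, i))) => (U l k * Y * W) p i - U l k p i
  | .inr (.inr (.inr (l, k, p, i))) =>
      if J l k < i then (U l k * (f l).adjugate) p i else 0

theorem map_sysE {R R' : Type} [CommRing R] [CommRing R'] (φ : R →+* R') (J : Fin s → Fin d → Fin r)
    (f : Fin s → Matrix (Fin r) (Fin r) R) (W : Matrix (Fin d) (Fin r) R)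
    (Y : Matrix (Fin r) (Fin d) R) (U : Fin s → Fin d → Matrix (Fin d) (Fin r) R)
    (D : Fin s → Fin d → Matrix (Fin r) (Fin d) R) (i) :
    φ (sysE J f W Y U D i) = sysE J (fun l => (f l).map φ) (W.map φ) (Y.map φ)
      (fun l k => (U l k).map φ) (fun l k => (D l k).map φ) i := by
  have hadj : ∀ l, ((f l).map φ).adjugate = ((f l).adjugate).map φ := by
    intro l
    exact (RingHom.map_adjugate φ (f l)).symm
  rcases i with ⟨p, p'⟩ | ⟨l, k, p, p'⟩ | ⟨l, k, p, i⟩ | ⟨l, k, p, i⟩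
  · simp only [sysE]
    rw [← Matrix.map_mul, map_sub]
    simp [Matrix.one_apply, apply_ite φ]
  · simp only [sysE]
    rw [← Matrix.map_mul, map_sub]
    simp [apply_ite φ]
  · simp only [sysE]
    rw [← Matrix.map_mul, ← Matrix.map_mul, map_sub]
    simp
  · simp only [sysE]
    rw [hadj, ← Matrix.map_mul, apply_ite φ]
    simp

theorem indep_of_mul_one {m r : ℕ} (A : Matrix (Fin m) (Fin r) ℂ) (B : Matrix (Fin r) (Fin m) ℂ)
    (h : A * B = 1) : LinearIndependent ℂ (fun i => A i) := by
  have := (Matrix.vecMul_injective_iff (M := A)).1 (by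
    intro x y hxy
    have h2 := congrArg (fun z => Matrix.vecMul z B) hxy
    simpa [Matrix.vecMul_vecMul, h] using h2)
  exact this

theorem mem_Fsp_iff {f : Matrix (Fin r) (Fin r) ℂ} (hf : LinearIndependent ℂ (fun i => f i))
    (x : Fin r → ℂ) (j : Fin r) :
    x ∈ Fsp (fun i => f i) j ↔ ∀ i, j < i → (Matrix.vecMul x f.adjugate) i = 0 := by
  have hu : IsUnit f := Matrix.linearIndependent_rows_iff_isUnit.1 hf
  have hdet : f.det ≠ 0 := ((Matrix.isUnit_iff_isUnit_det f).1 hu).ne_zero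
  constructor
  · intro hx i hi
    refine Submodule.span_induction (p := fun x _ => (Matrix.vecMul x f.adjugate) i = 0) ?_ ?_ ?_ ?_ hx
    · rintro _ ⟨k, hk, rfl⟩
      have : Matrix.vecMul (f k) f.adjugate i = (f * f.adjugate) k i := by
        simp [Matrix.vecMul, Matrix.mul_apply, dotProduct]
      rw [this, Matrix.mul_adjugate]
      have hne : k ≠ i := (lt_of_le_of_lt hk hi).ne
      simp [Matrix.one_apply, hne]
    · simp
    · intro a b _ _ ha hb
      simp [Matrix.add_vecMul, ha, hb]
    · intro c a _ ha
      simp [Matrix.smul_vecMul, ha]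
  · intro h
    have hx : f.det • x = ∑ i, (Matrix.vecMul x f.adjugate) i • f i := by
      have : Matrix.vecMul (Matrix.vecMul x f.adjugate) f = f.det • x := by
        rw [Matrix.vecMul_vecMul, Matrix.adjugate_mul, Matrix.vecMul_smul, Matrix.vecMul_one]
      rw [← this]
      ext k
      simp [Matrix.vecMul, dotProduct, Finset.sum_apply]
    rw [← Submodule.smul_mem_iff _ hdet, hx]
    refine Submodule.sum_mem _ (fun i _ => ?_)
    by_cases hi : j < i
    · rw [h i hi, zero_smul]; exact Submodule.zero_mem _
    · exact Submodule.smul_mem _ _ (mem_Fsp _ (not_lt.1 hi))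

theorem Zp_of_sys {J : Fin s → Fin d → Fin r} {f : Fin s → Fin r → Fin r → ℂ} (hf : Frame f)
    {W : Matrix (Fin d) (Fin r) ℂ} {Y : Matrix (Fin r) (Fin d) ℂ}
    {U : Fin s → Fin d → Matrix (Fin d) (Fin r) ℂ} {D : Fin s → Fin d → Matrix (Fin r) (Fin d) ℂ}
    (h : ∀ i, sysE J f W Y U D i = 0) : Zp J f := by
  have h1 : W * Y = 1 := by
    ext p p'
    exact sub_eq_zero.1 (h (.inl (p, p')))
  have hW := indep_of_mul_one W Y h1
  refine ⟨Submodule.span ℂ (Set.range (fun i => W i)), ?_, fun l k => ?_⟩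
  · rw [finrank_span_eq_card hW, Fintype.card_fin]
  · have hk : (k : ℕ) + 1 ≤ d := k.2
    let c : Fin (k + 1) → Fin d := Fin.castLE hk
    have hc : ∀ p, c p ≤ k := fun p => by
      rw [Fin.le_def]; simp only [c, Fin.val_castLE]; omega
    have hind : LinearIndependent ℂ (fun p => U l k (c p)) := by
      refine indep_of_mul_one (Matrix.of fun p i => U l k (c p) i) (Matrix.of fun i p => D l k i (c p)) ?_
      ext p p'
      have := sub_eq_zero.1 (h (.inr (.inl (l, k, c p, c p'))))
      rw [Matrix.mul_apply] at this ⊢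
      simp only [Matrix.of_apply]
      rw [this, Matrix.one_apply]
      simp [hc, c]
    have hmem : ∀ p, U l k (c p) ∈ Submodule.span ℂ (Set.range (fun i => W i)) ⊓ Fsp (f l) (J l k) := by
      intro p
      refine ⟨?_, ?_⟩
      · have : U l k (c p) = ∑ q, (U l k * Y) (c p) q • W q := by
          ext i
          have := sub_eq_zero.1 (h (.inr (.inr (.inl (l, k, c p, i)))))
          rw [← this, Matrix.mul_apply]
          simp
        rw [this]
        exact Submodule.sum_mem _ (fun q _ => Submodule.smul_mem _ _ (Submodule.subset_span ⟨q, rfl⟩))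
      · refine (mem_Fsp_iff (f := f l) (hf l) _ _).2 (fun i hi => ?_)
        have := h (.inr (.inr (.inr (l, k, c p, i))))
        simp only [sysE, hi, if_true] at this
        exact this
    have := (LinearIndependent.of_comp (Submodule.subtype _) (v := fun p => (⟨U l k (c p), hmem p⟩ :
      ↥(Submodule.span ℂ (Set.range (fun i => W i)) ⊓ Fsp (f l) (J l k)))) hind).fintype_card_le_finrank
    simpa using this

theorem exists_orthonormal_rows {m : ℕ} (V : Submodule ℂ (Fin r → ℂ)) (hm : m ≤ finrank ℂ V) :
    ∃ U : Matrix (Fin m) (Fin r) ℂ, U * U.conjTranspose = 1 ∧ ∀ p, U p ∈ V := by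
  let e := WithLp.linearEquiv 2 ℂ (Fin r → ℂ)
  let V' : Submodule ℂ (EuclideanSpace ℂ (Fin r)) := V.comap e.toLinearMap
  have hfin : finrank ℂ V' = finrank ℂ V := by
    have h1 : V'.map e.toLinearMap = V := by
      exact Submodule.map_comap_eq_of_surjective e.surjective _
    rw [← h1]
    exact (e.finrank_map_eq V').symm
  let b := stdOrthonormalBasis ℂ V'
  let c : Fin m → Fin (finrank ℂ V') := Fin.castLE (by rw [hfin]; exact hm)
  refine ⟨Matrix.of fun p => e (b (c p) : EuclideanSpace ℂ (Fin r)), ?_, fun p => (b (c p)).2⟩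
  ext p p'
  have h1 := orthonormal_iff_ite.1 b.orthonormal (c p') (c p)
  rw [Submodule.coe_inner, PiLp.inner_apply] at h1
  rw [Matrix.mul_apply, Matrix.one_apply]
  have : (p = p') ↔ (c p' = c p) := by
    simp [c, eq_comm]
  simp only [this]
  rw [← h1]
  refine Finset.sum_congr rfl (fun i _ => ?_)
  simp [e, Matrix.conjTranspose_apply]

theorem sys_of_Zp {J : Fin s → Fin d → Fin r} {f : Fin s → Fin r → Fin r → ℂ} (hf : Frame f)
    (h : Zp J f) : ∃ (W : Matrix (Fin d) (Fin r) ℂ) (U : Fin s → Fin d → Matrix (Fin d) (Fin r) ℂ),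
      ∀ i, sysE J f W W.conjTranspose U (fun l k => (U l k).conjTranspose) i = 0 := by
  obtain ⟨V, hV, hV2⟩ := h
  obtain ⟨W, hW, hWV⟩ := exists_orthonormal_rows V hV.ge
  choose U hU hUV using fun l k => exists_orthonormal_rows _ (hV2 l k)
  have hWi := indep_of_mul_one W _ hW
  have hspan : Submodule.span ℂ (Set.range (fun i => W i)) = V := by
    apply Submodule.eq_of_le_of_finrank_eq
    · refine Submodule.span_le.2 ?_
      rintro _ ⟨i, rfl⟩
      exact hWV i
    · rw [finrank_span_eq_card hWi, Fintype.card_fin, hV]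
  have hproj : ∀ x ∈ V, Matrix.vecMul (Matrix.vecMul x W.conjTranspose) W = x := by
    intro x hx
    rw [← hspan] at hx
    refine Submodule.span_induction (p := fun x _ =>
      Matrix.vecMul (Matrix.vecMul x W.conjTranspose) W = x) ?_ ?_ ?_ ?_ hx
    · rintro _ ⟨k, rfl⟩
      have : W k = Matrix.vecMul (Pi.single k 1) W := by simp; rfl
      simp only
      rw [this, Matrix.vecMul_vecMul _ W, hW]
      simp
    · simp
    · intro a b _ _ ha hb
      simp only [Matrix.add_vecMul, ha, hb]
    · intro c a _ ha
      simp only [Matrix.smul_vecMul, ha]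
  let U' : Fin s → Fin d → Matrix (Fin d) (Fin r) ℂ := fun l k => Matrix.of fun p =>
    if hp : (p : ℕ) < k + 1 then U l k ⟨p, hp⟩ else 0
  have hU'1 : ∀ (l : Fin s) (k p : Fin d) (hp : (p : ℕ) < k + 1) i, U' l k p i = U l k ⟨p, hp⟩ i := by
    intro l k p hp i
    simp only [U', Matrix.of_apply, hp, dite_true]
  have hU'2 : ∀ (l : Fin s) (k p : Fin d) (hp : ¬ (p : ℕ) < k + 1) i, U' l k p i = 0 := by
    intro l k p hp i
    simp only [U', Matrix.of_apply, hp, dite_false, Pi.zero_apply]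
  have hU'V : ∀ l k p, U' l k p ∈ V ⊓ Fsp (f l) (J l k) := by
    intro l k p
    by_cases hp : (p : ℕ) < k + 1
    · have : U' l k p = U l k ⟨p, hp⟩ := funext (hU'1 l k p hp)
      rw [this]
      exact hUV _ _ _
    · have : U' l k p = 0 := funext (hU'2 l k p hp)
      rw [this]
      exact Submodule.zero_mem _
  refine ⟨W, U', ?_⟩
  rintro (⟨p, p'⟩ | ⟨l, k, p, p'⟩ | ⟨l, k, p, i⟩ | ⟨l, k, p, i⟩)
  · simp only [sysE, hW, sub_self]
  · simp only [sysE]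
    rw [sub_eq_zero, Matrix.mul_apply]
    by_cases hp : (p : ℕ) < k + 1
    · by_cases hp' : (p' : ℕ) < k + 1
      · have := congrFun (congrFun (hU l k) ⟨p, hp⟩) ⟨p', hp'⟩
        rw [Matrix.mul_apply, Matrix.one_apply] at this
        have h2 : p ≤ k := by rw [Fin.le_def]; omega
        simp only [Matrix.conjTranspose_apply, hU'1 _ _ _ hp, hU'1 _ _ _ hp'] at this ⊢
        rw [this]
        simp [h2, Fin.ext_iff]
      · have h3 : p ≠ p' := by rintro rfl; exact hp' hp
        simp [hU'2 _ _ _ hp', h3]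
    · have h3 : ¬ p ≤ k := by rw [Fin.le_def]; omega
      simp [hU'2 _ _ _ hp, h3]
  · simp only [sysE]
    rw [sub_eq_zero]
    have := hproj _ (hU'V l k p).1
    exact congrFun this i
  · simp only [sysE]
    split_ifs with hi
    · exact (mem_Fsp_iff (f := f l) (hf l) _ _).1 (hU'V l k p).2 i hi
    · rfl

end sys

section closed
variable {s d r : ℕ}

theorem norm_le_one_of_row {r : ℕ} (z : Fin r → ℂ) (P : Prop) [Decidable P]
    (h : ∑ i, z i * star (z i) = if P then 1 else 0) (i : Fin r) : ‖z i‖ ≤ 1 := by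
  have h1 : ∀ i, z i * star (z i) = ((‖z i‖ ^ 2 : ℝ) : ℂ) := by
    intro i
    have := Complex.mul_conj' (z i)
    simpa using this
  simp only [h1] at h
  rw [← Complex.ofReal_sum] at h
  have h2 : ∑ i, ‖z i‖ ^ 2 ≤ 1 := by
    split_ifs at h
    · have : ∑ i, ‖z i‖ ^ 2 = 1 := by exact_mod_cast h
      exact this.le
    · have : ∑ i, ‖z i‖ ^ 2 = 0 := by exact_mod_cast h
      rw [this]; exact zero_le_one
  have h3 : ‖z i‖ ^ 2 ≤ ∑ i, ‖z i‖ ^ 2 :=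
    Finset.single_le_sum (f := fun i => ‖z i‖ ^ 2) (fun i _ => sq_nonneg _) (Finset.mem_univ i)
  have h4 : ‖z i‖ ^ 2 ≤ 1 := h3.trans h2
  nlinarith [norm_nonneg (z i)]

theorem continuous_sysE (J : Fin s → Fin d → Fin r) {X : Type*} [TopologicalSpace X]
    (f : X → Fin s → Matrix (Fin r) (Fin r) ℂ) (W : X → Matrix (Fin d) (Fin r) ℂ)
    (Y : X → Matrix (Fin r) (Fin d) ℂ) (U : X → Fin s → Fin d → Matrix (Fin d) (Fin r) ℂ)
    (D : X → Fin s → Fin d → Matrix (Fin r) (Fin d) ℂ) (hf : Continuous f) (hW : Continuous W)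
    (hY : Continuous Y) (hU : Continuous U) (hD : Continuous D) (i) :
    Continuous (fun x => sysE J (f x) (W x) (Y x) (U x) (D x) i) := by
  have hU' : ∀ l k, Continuous (fun x => U x l k) := fun l k => by fun_prop
  have hD' : ∀ l k, Continuous (fun x => D x l k) := fun l k => by fun_prop
  have hf' : ∀ l, Continuous (fun x => f x l) := fun l => by fun_prop
  rcases i with ⟨p, p'⟩ | ⟨l, k, p, p'⟩ | ⟨l, k, p, i⟩ | ⟨l, k, p, i⟩
  · simp only [sysE]
    exact ((hW.matrix_mul hY).matrix_elem p p').sub continuous_const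
  · simp only [sysE]
    exact (((hU' l k).matrix_mul (hD' l k)).matrix_elem p p').sub continuous_const
  · simp only [sysE]
    exact ((((hU' l k).matrix_mul hY).matrix_mul hW).matrix_elem p i).sub ((hU' l k).matrix_elem p i)
  · simp only [sysE]
    split_ifs
    · exact ((hU' l k).matrix_mul (hf' l).matrix_adjugate).matrix_elem p i
    · exact continuous_const

theorem closed_Zp (J : Fin s → Fin d → Fin r) :
    ∃ K : Set (Fin s → Fin r → Fin r → ℂ), IsClosed K ∧ ∀ f, Frame f → (f ∈ K ↔ Zp J f) := by
  let B : Set ((Fin d → Fin r → ℂ) × (Fin s → Fin d → Fin d → Fin r → ℂ)) := Metric.closedBall 0 1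
  have hB : CompactSpace B := isCompact_iff_compactSpace.1 (isCompact_closedBall 0 1)
  let C : Set ((Fin s → Fin r → Fin r → ℂ) × B) :=
    {z | ∀ i, sysE J (fun l => Matrix.of (z.1 l)) (Matrix.of z.2.1.1) (Matrix.of z.2.1.1).conjTranspose
      (fun l k => Matrix.of (z.2.1.2 l k)) (fun l k => (Matrix.of (z.2.1.2 l k)).conjTranspose) i = 0}
  have hC : IsClosed C := by
    simp only [C, Set.ofPred_forall]
    refine isClosed_iInter (fun i => ?_)
    refine isClosed_eq ?_ continuous_const
    have cof : ∀ {a b : ℕ}, Continuous (Matrix.of : (Fin a → Fin b → ℂ) → Matrix (Fin a) (Fin b) ℂ) :=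
      fun {a b} => continuous_id
    have hU : ∀ l k, Continuous (fun z : (Fin s → Fin r → Fin r → ℂ) × B => Matrix.of (z.2.1.2 l k)) :=
      fun l k => cof.comp (by fun_prop)
    have hW : Continuous (fun z : (Fin s → Fin r → Fin r → ℂ) × B => Matrix.of z.2.1.1) :=
      cof.comp (by fun_prop)
    apply continuous_sysE
    · exact continuous_pi (fun l => cof.comp (by fun_prop))
    · exact hW
    · exact hW.matrix_conjTranspose
    · exact continuous_pi (fun l => continuous_pi (fun k => hU l k))
    · exact continuous_pi (fun l => continuous_pi (fun k => (hU l k).matrix_conjTranspose))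
  refine ⟨Prod.fst '' C, isClosedMap_fst_of_compactSpace _ hC, fun f hf => ⟨?_, ?_⟩⟩
  · rintro ⟨⟨f', x⟩, hx, rfl⟩
    exact Zp_of_sys hf hx
  · intro h
    obtain ⟨W, U, hWU⟩ := sys_of_Zp hf h
    have hx : ((W, U) : (Fin d → Fin r → ℂ) × (Fin s → Fin d → Fin d → Fin r → ℂ)) ∈ B := by
      rw [mem_closedBall_zero_iff, Prod.norm_def]
      refine max_le ?_ ?_
      · refine (pi_norm_le_iff_of_nonneg zero_le_one).2 (fun p => ?_)
        refine (pi_norm_le_iff_of_nonneg zero_le_one).2 (fun i => ?_)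
        have := sub_eq_zero.1 (hWU (.inl (p, p)))
        rw [Matrix.mul_apply, Matrix.one_apply] at this
        exact norm_le_one_of_row (W p) (p = p) this i
      · refine (pi_norm_le_iff_of_nonneg zero_le_one).2 (fun l => ?_)
        refine (pi_norm_le_iff_of_nonneg zero_le_one).2 (fun k => ?_)
        refine (pi_norm_le_iff_of_nonneg zero_le_one).2 (fun p => ?_)
        refine (pi_norm_le_iff_of_nonneg zero_le_one).2 (fun i => ?_)
        have := sub_eq_zero.1 (hWU (.inr (.inl (l, k, p, p))))
        rw [Matrix.mul_apply] at this
        exact norm_le_one_of_row (U l k p) (p = p ∧ p ≤ k) this i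
    exact ⟨(f, ⟨(W, U), hx⟩), hWU, rfl⟩

theorem dich_line (J : Fin s → Fin d → Fin r) (f y : Fin s → Fin r → Fin r → ℂ) :
    ∃ K : Set ℂ, (K.Finite ∨ Kᶜ.Finite) ∧ ∀ t, Frame (f + t • y) → (t ∈ K ↔ Zp J (f + t • y)) := by
  let τ := (Fin d × Fin r) ⊕ ((Fin r × Fin d) ⊕ ((Fin s × Fin d × Fin d × Fin r) ⊕
    (Fin s × Fin d × Fin r × Fin d)))
  let R := MvPolynomial τ (Polynomial ℂ)
  let F : Fin s → Matrix (Fin r) (Fin r) R := fun l => Matrix.of fun i j =>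
    MvPolynomial.C (Polynomial.C (f l i j) + Polynomial.X * Polynomial.C (y l i j))
  let W : Matrix (Fin d) (Fin r) R := Matrix.of fun p i => MvPolynomial.X (.inl (p, i))
  let Y : Matrix (Fin r) (Fin d) R := Matrix.of fun i p => MvPolynomial.X (.inr (.inl (i, p)))
  let U : Fin s → Fin d → Matrix (Fin d) (Fin r) R := fun l k => Matrix.of fun p i =>
    MvPolynomial.X (.inr (.inr (.inl (l, k, p, i))))
  let D : Fin s → Fin d → Matrix (Fin r) (Fin d) R := fun l k => Matrix.of fun i p =>
    MvPolynomial.X (.inr (.inr (.inr (l, k, i, p))))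
  have key := gen_dichotomy (Set.range (sysE J F W Y U D))
  refine ⟨_, key, fun t ht => ?_⟩
  have hF : ∀ x : τ → ℂ, (fun l => (F l).map (MvPolynomial.eval₂Hom (Polynomial.evalRingHom t) x)) =
      fun l => Matrix.of ((f + t • y) l) := by
    intro x
    funext l
    ext i j
    simp [F]
    ring
  constructor
  · rintro ⟨x, hx⟩
    have h1 := fun i => hx _ (Set.mem_range_self i)
    have h2 : ∀ i, MvPolynomial.eval₂Hom (Polynomial.evalRingHom t) x (sysE J F W Y U D i) = 0 := h1
    simp only [map_sysE, hF] at h2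
    exact Zp_of_sys ht h2
  · intro h
    obtain ⟨W', U', hWU⟩ := sys_of_Zp ht h
    refine ⟨fun z => match z with
      | .inl (p, i) => W' p i
      | .inr (.inl (i, p)) => W'.conjTranspose i p
      | .inr (.inr (.inl (l, k, p, i))) => U' l k p i
      | .inr (.inr (.inr (l, k, i, p))) => (U' l k).conjTranspose i p, ?_⟩
    rintro _ ⟨i, rfl⟩
    change MvPolynomial.eval₂Hom (Polynomial.evalRingHom t) _ (sysE J F W Y U D i) = 0
    rw [map_sysE, hF, ← hWU i]
    congr 1
    · ext p i; simp [W]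
    · ext p i; simp [Y]
    · funext l k; ext p i; simp [U]
    · funext l k; ext p i; simp [D]

theorem Frame_lineOpen : LineOpen (fun f : Fin s → Fin r → Fin r → ℂ => Frame f) := by
  apply LineOpen.forall_fin
  intro l f hf y
  exact lin0 (f l) (y l) hf

theorem ZL1 (J : Fin s → Fin d → Fin r) :
    LineOpen (fun f : Fin s → Fin r → Fin r → ℂ => Frame f ∧ ¬ Zp J f) := by
  rintro f ⟨hf, hZ⟩ y
  obtain ⟨K, hK, hKZ⟩ := dich_line J f y
  obtain ⟨C, hC, hCZ⟩ := closed_Zp J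
  have hfr := Frame_lineOpen f hf y
  have hopen : IsOpen {t : ℂ | f + t • y ∉ C} :=
    (hC.preimage (f := fun t : ℂ => f + t • y) (by fun_prop)).isOpen_compl
  have hmem : (0 : ℂ) ∈ {t : ℂ | f + t • y ∉ C} := by
    have : f ∉ C := fun h => hZ ((hCZ f hf).1 h)
    simpa using this
  have hinf : {t : ℂ | f + t • y ∉ C}.Infinite :=
    infinite_of_mem_nhds 0 (hopen.mem_nhds hmem)
  have hKfin : K.Finite := by
    rcases hK with h | h
    · exact h
    · exfalso
      apply hinf
      refine (h.union hfr).subset ?_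
      intro t ht
      by_contra hcon
      simp only [Set.mem_union, not_or, Set.mem_compl_iff, not_not, Set.mem_ofPred_eq] at hcon
      exact ht ((hCZ _ hcon.2).2 ((hKZ t hcon.2).1 hcon.1))
  refine (hKfin.union hfr).subset ?_
  intro t ht
  by_contra hcon
  simp only [Set.mem_union, not_or, Set.mem_ofPred_eq, not_not] at hcon
  exact ht ⟨hcon.2, fun h => hcon.1 ((hKZ t hcon.2).2 h)⟩

/-- If every frame satisfies one of finitely many incidence conditions, one of them is generic. -/
theorem exists_generic {ι : Type*} [Finite ι] {dd : ι → ℕ} (J : ∀ i, Fin s → Fin (dd i) → Fin r)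
    (h : ∀ f : Fin s → Fin r → Fin r → ℂ, Frame f → ∃ i, Zp (J i) f) :
    ∃ i, ∀ f : Fin s → Fin r → Fin r → ℂ, Frame f → Zp (J i) f := by
  by_contra hcon
  push Not at hcon
  have := LineOpen.exists_forall (P := fun i (f : Fin s → Fin r → Fin r → ℂ) => Frame f ∧ ¬ Zp (J i) f)
    (fun i => ZL1 (J i)) (fun i => by obtain ⟨f, h1, h2⟩ := hcon i; exact ⟨f, h1, h2⟩)
  obtain ⟨f, hf⟩ := this
  have hne : Nonempty ι := by
    by_contra hem
    have hem' : IsEmpty ι := not_nonempty_iff.1 hem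
    obtain ⟨i, -⟩ := h (fun _ => Pi.basisFun ℂ (Fin r)) (fun _ => (Pi.basisFun ℂ (Fin r)).linearIndependent)
    exact hem'.elim i
  obtain ⟨i0⟩ := hne
  obtain ⟨i, hi⟩ := h f (hf i0).1
  exact (hf i).2 hi

/-- If an incidence condition holds near a point, it holds for all frames. -/
theorem generic_of_open (J : Fin s → Fin d → Fin r) (f0 : Fin s → Fin r → Fin r → ℂ) (h0 : Frame f0)
    (h : ∀ᶠ f in nhds f0, Zp J f) (f : Fin s → Fin r → Fin r → ℂ) (hf : Frame f) : Zp J f := by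
  by_contra hZ
  have hfin := ZL1 J f ⟨hf, hZ⟩ (f0 - f)
  have hcont : Filter.Tendsto (fun t : ℂ => f + t • (f0 - f)) (nhds 1) (nhds f0) := by
    have : Continuous (fun t : ℂ => f + t • (f0 - f)) := by fun_prop
    have h2 := this.tendsto 1
    simpa using h2
  have hinf : {t : ℂ | Zp J (f + t • (f0 - f))}.Infinite :=
    infinite_of_mem_nhds 1 (hcont.eventually h)
  apply hinf
  refine hfin.subset ?_
  intro t ht h2
  exact h2.2 ht

end closed

section posdim
variable {s d r : ℕ}

theorem pos_span {b : Fin r → Fin r → ℂ} (hb : LinearIndependent ℂ b)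
    {S : Submodule ℂ (Fin r → ℂ)} (hd : finrank ℂ S = d) {J : Fin d → Fin r}
    (hJ : Function.Injective J) (hbS : ∀ k, b (J k) ∈ S) :
    Submodule.span ℂ (b '' Set.range J) = S := by
  apply Submodule.eq_of_le_of_finrank_eq
  · refine Submodule.span_le.2 ?_
    rintro _ ⟨_, ⟨k, rfl⟩, rfl⟩
    exact hbS k
  · rw [hd, ← Set.range_comp]
    rw [finrank_span_eq_card (hb.comp J hJ), Fintype.card_fin]

theorem pos_dim {b : Fin r → Fin r → ℂ} (hb : LinearIndependent ℂ b)
    {S : Submodule ℂ (Fin r → ℂ)} (hd : finrank ℂ S = d) {J : Fin d → Fin r}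
    (hJ : Function.Injective J) (hbS : ∀ k, b (J k) ∈ S) (A : Set (Fin r)) [DecidablePred (· ∈ A)] :
    finrank ℂ ↥(S ⊓ Submodule.span ℂ (b '' A)) = (Finset.univ.filter (fun k => J k ∈ A)).card := by
  classical
  let B := basisOfLinearIndependentOfCardEqFinrank' b hb (by simp)
  have hB : ⇑B = b := by simp [B]
  have h1 : S ⊓ Submodule.span ℂ (b '' A) =
      Submodule.span ℂ (b '' (((Finset.univ.filter (fun k => J k ∈ A)).map ⟨J, hJ⟩ : Finset (Fin r)) :
        Set (Fin r))) := by
    rw [← pos_span hb hd hJ hbS]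
    ext x
    rw [Submodule.mem_inf, ← hB, B.mem_span_image, B.mem_span_image, B.mem_span_image,
      ← Set.subset_inter_iff]
    have : Set.range J ∩ A = (((Finset.univ.filter (fun k => J k ∈ A)).map ⟨J, hJ⟩ : Finset (Fin r)) :
        Set (Fin r)) := by
      ext i
      simp only [Set.mem_inter_iff, Set.mem_range, Finset.coe_map, Function.Embedding.coeFn_mk,
        Set.mem_image, Finset.mem_coe, Finset.mem_filter, Finset.mem_univ, true_and]
      constructor
      · rintro ⟨⟨k, rfl⟩, h⟩; exact ⟨k, h, rfl⟩
      · rintro ⟨k, h, rfl⟩; exact ⟨⟨k, rfl⟩, h⟩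
    rw [this]
  rw [h1, finrank_span_image hb, Finset.card_map]

theorem pos_le {f b : Fin r → Fin r → ℂ} (hf : LinearIndependent ℂ f) (hb : LinearIndependent ℂ b)
    (hbf : ∀ j, b j ∈ Fsp f j)
    {S : Submodule ℂ (Fin r → ℂ)} (hd : finrank ℂ S = d) {J : Fin d → Fin r}
    (hJ : StrictMono J) (hbS : ∀ k, b (J k) ∈ S) (k : Fin d) (i : Fin r)
    (h : (k : ℕ) + 1 ≤ finrank ℂ ↥(S ⊓ Fsp f i)) : J k ≤ i := by
  classical
  rw [← Fsp_eq_of_mem hf hb hbf, Fsp, pos_dim hb hd hJ.injective hbS] at h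
  by_contra hcon
  have hsub : (Finset.univ.filter (fun k => J k ∈ Set.Iic i)) ⊆ Finset.Iio k := by
    intro k' hk'
    simp only [Finset.mem_filter, Finset.mem_univ, true_and, Set.mem_Iic] at hk'
    rw [Finset.mem_Iio]
    exact hJ.lt_iff_lt.1 (lt_of_le_of_lt hk' (not_le.1 hcon))
  have := Finset.card_le_card hsub
  rw [Fin.card_Iio] at this
  omega

theorem mem_sup_of_pos {f b : Fin r → Fin r → ℂ} (hf : LinearIndependent ℂ f)
    (hb : LinearIndependent ℂ b) (hbf : ∀ j, b j ∈ Fsp f j)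
    {S : Submodule ℂ (Fin r → ℂ)} {J : Fin d → Fin r} (hbS : ∀ k, b (J k) ∈ S) (j : Fin r) :
    f j ∈ S ⊔ Submodule.span ℂ (f '' {i | i ≤ j ∧ i ∉ Set.range J}) := by
  induction j using WellFoundedLT.induction with
  | ind j ih =>
    by_cases hj : j ∈ Set.range J
    · obtain ⟨k, rfl⟩ := hj
      have h1 : b (J k) ∈ Submodule.span ℂ (insert (f (J k)) (f '' Set.Iio (J k))) := by
        rw [← Set.image_insert_eq, Set.Iio_insert]
        exact hbf (J k)
      obtain ⟨c, z, hz, hcz⟩ := Submodule.mem_span_insert.1 h1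
      have hc : c ≠ 0 := by
        rintro rfl
        rw [zero_smul, zero_add] at hcz
        rw [← hcz, ← span_lower_eq hf hb hbf (isLowerSet_Iio _)] at hz
        exact indep_notMem hb _ hz
      have hz2 : z ∈ S ⊔ Submodule.span ℂ (f '' {i | i ≤ J k ∧ i ∉ Set.range J}) := by
        refine Submodule.span_le.2 ?_ hz
        rintro _ ⟨i, hi, rfl⟩
        refine sup_le_sup_left (Submodule.span_mono (Set.image_mono ?_)) S (ih i hi)
        rintro i' ⟨h1, h2⟩
        exact ⟨h1.trans hi.le, h2⟩
      have hf2 : c • f (J k) = b (J k) - z := by rw [hcz]; abel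
      rw [← Submodule.smul_mem_iff _ hc, hf2]
      exact sub_mem (Submodule.mem_sup_left (hbS k)) hz2
    · exact Submodule.mem_sup_right (Submodule.subset_span ⟨j, ⟨le_rfl, hj⟩, rfl⟩)
end posdim

/-! ### Intersecting tuples have nonnegative expected dimension (dimension count) -/

section dimcount
variable {s r n : ℕ}

abbrev IdxA (A : Fin r → Fin n) : Type := {x : Fin r × Fin n // x.2 ∉ Set.range A}

abbrev badL (J : Fin r → Fin n) (x : Fin n × Fin n) : Prop :=
  x.1 ∈ Set.range J ∧ x.2 ∉ Set.range J ∧ x.1 < x.2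

abbrev IdxL (J : Fin r → Fin n) : Type := {x : Fin n × Fin n // ¬ badL J x}

open Classical in
def Xmat (A : Fin r → Fin n) (N : IdxA A → ℂ) (p : Fin r) (i : Fin n) : ℂ :=
  if h : i ∉ Set.range A then N ⟨(p, i), h⟩ else if A p = i then 1 else 0

open Classical in
def Mmat (J : Fin r → Fin n) (M : IdxL J → ℂ) (j i : Fin n) : ℂ :=
  if h : ¬ badL J (j, i) then M ⟨(j, i), h⟩ else 0

abbrev IdxT (A : Fin r → Fin n) (J : Fin s → Fin r → Fin n) : Type :=
  IdxA A ⊕ (Σ l, IdxL (J l))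

open Classical in
def PhiA (A : Fin r → Fin n) (J : Fin s → Fin r → Fin n) (z : IdxT A J → ℂ)
    (l : Fin s) (j i' : Fin n) : ℂ :=
  if j ∈ Set.range (J l) then
    ∑ i, Mmat (J l) (fun x => z (.inr ⟨l, x⟩)) j i *
      (if i ∈ Set.range (J l) then ∑ p, if J l p = i then Xmat A (fun x => z (.inl x)) p i' else 0
        else Mmat (J l) (fun x => z (.inr ⟨l, x⟩)) i i')
  else Mmat (J l) (fun x => z (.inr ⟨l, x⟩)) j i'

theorem contDiff_PhiA (A : Fin r → Fin n) (J : Fin s → Fin r → Fin n) : ContDiff ℝ 1 (PhiA A J) := by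
  classical
  have hX : ∀ p i, ContDiff ℝ 1 (fun z : IdxT A J → ℂ => Xmat A (fun x => z (.inl x)) p i) := by
    intro p i
    unfold Xmat
    split_ifs
    · fun_prop
    · fun_prop
    · fun_prop
  have hM : ∀ l j i, ContDiff ℝ 1 (fun z : IdxT A J → ℂ => Mmat (J l) (fun x => z (.inr ⟨l, x⟩)) j i) := by
    intro l j i
    unfold Mmat
    split_ifs
    · fun_prop
    · fun_prop
  refine contDiff_pi.2 (fun l => contDiff_pi.2 (fun j => contDiff_pi.2 (fun i' => ?_)))
  unfold PhiA
  split_ifs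
  · refine ContDiff.sum (fun i _ => (hM l j i).mul ?_)
    split_ifs
    · refine ContDiff.sum (fun p _ => ?_)
      split_ifs
      · exact hX p i'
      · exact contDiff_const
    · exact hM l i i'
  · exact hM l j i'

theorem card_IdxA (A : Fin r → Fin n) (hA : Function.Injective A) :
    (Nat.card (IdxA A) : ℤ) = r * ((n : ℤ) - r) := by
  classical
  have e : IdxA A ≃ Fin r × {i : Fin n // i ∉ Set.range A} :=
    { toFun := fun x => (x.1.1, ⟨x.1.2, x.2⟩)
      invFun := fun y => ⟨(y.1, y.2.1), y.2.2⟩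
      left_inv := fun x => rfl
      right_inv := fun y => rfl }
  rw [Nat.card_congr e, Nat.card_prod, Nat.card_eq_fintype_card, Nat.card_eq_fintype_card,
    Fintype.card_subtype_compl]
  have h1 : Fintype.card {i : Fin n // i ∈ Set.range A} = r := by
    rw [← Fintype.card_congr (Equiv.ofInjective A hA), Fintype.card_fin]
  rw [h1]
  have h2 : r ≤ n := by simpa using Fintype.card_le_of_injective A hA
  push_cast
  simp [Nat.cast_sub h2]

theorem card_gap (J : Fin r → Fin n) (hJ : StrictMono J) (k : Fin r) [DecidablePred (· ∈ Set.range J)] :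
    ((Finset.univ.filter (fun i => i ∉ Set.range J ∧ J k < i)).card : ℤ) =
      ((n : ℤ) - r) - ((J k : ℤ) - k) := by
  classical
  have h1 : (Finset.Ioi (J k)).card = ((Finset.Ioi (J k)).filter (fun i => i ∈ Set.range J)).card +
      ((Finset.Ioi (J k)).filter (fun i => ¬ i ∈ Set.range J)).card :=
    (Finset.card_filter_add_card_filter_not _).symm
  have h2 : (Finset.Ioi (J k)).filter (fun i => i ∈ Set.range J) =
      (Finset.Ioi k).map ⟨J, hJ.injective⟩ := by
    ext i
    simp only [Finset.mem_filter, Finset.mem_Ioi, Finset.mem_map, Function.Embedding.coeFn_mk, Set.mem_range]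
    constructor
    · rintro ⟨h, k', rfl⟩
      exact ⟨k', hJ.lt_iff_lt.1 h, rfl⟩
    · rintro ⟨k', h, rfl⟩
      exact ⟨hJ h, k', rfl⟩
  have h3 : (Finset.Ioi (J k)).filter (fun i => ¬ i ∈ Set.range J) =
      Finset.univ.filter (fun i => i ∉ Set.range J ∧ J k < i) := by
    ext i
    simp [and_comm]
  rw [h2, h3, Finset.card_map, Fin.card_Ioi, Fin.card_Ioi] at h1
  have := k.2
  have := (J k).2
  omega

theorem card_IdxL (J : Fin r → Fin n) (hJ : StrictMono J) :
    (Nat.card (IdxL J) : ℤ) = (n : ℤ) * n - (r * ((n : ℤ) - r) - dimI J) := by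
  classical
  have hle : Fintype.card {x : Fin n × Fin n // badL J x} ≤ Fintype.card (Fin n × Fin n) :=
    Fintype.card_subtype_le _
  rw [Nat.card_eq_fintype_card, Fintype.card_subtype_compl, Nat.cast_sub hle]
  have h1 : (Fintype.card {x : Fin n × Fin n // badL J x} : ℤ) = r * ((n : ℤ) - r) - dimI J := by
    rw [Fintype.card_subtype, Finset.card_filter, Fintype.sum_prod_type]
    push_cast
    have h2 : ∀ j : Fin n, (∑ i, if badL J (j, i) then (1 : ℤ) else 0) =
        if j ∈ Finset.univ.image J then
          ((Finset.univ.filter (fun i => i ∉ Set.range J ∧ j < i)).card : ℤ) else 0 := by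
      intro j
      by_cases hj : j ∈ Set.range J
      · have hj' : j ∈ Finset.univ.image J := by simpa using hj
        simp only [badL, hj, hj', true_and, if_true]
        rw [Finset.card_filter]
        push_cast
        rfl
      · have hj' : j ∉ Finset.univ.image J := by simpa using hj
        simp [badL, hj', hj]
    simp only [h2]
    rw [Finset.sum_ite_mem, Finset.univ_inter, Finset.sum_image hJ.injective.injOn]
    simp only [card_gap J hJ]
    rw [Finset.sum_sub_distrib]
    simp [dimI]
    ring
  rw [h1]
  simp

theorem card_IdxT (A : Fin r → Fin n) (hA : Function.Injective A) (J : Fin s → Fin r → Fin n)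
    (hJ : ∀ l, StrictMono (J l)) :
    (Nat.card (IdxT A J) : ℤ) = s * (n * n) + edim J := by
  rw [Nat.card_sum, Nat.card_sigma]
  push_cast
  rw [card_IdxA A hA, Finset.sum_congr rfl (fun l _ => card_IdxL (J l) (hJ l)), edim]
  rw [Finset.sum_sub_distrib]
  simp
  ring

end dimcount

section dimcount2
variable {s r n : ℕ}

theorem exists_chart (V : Submodule ℂ (Fin n → ℂ)) (hV : finrank ℂ V = r) :
    ∃ (A : Fin r → Fin n) (X : Fin r → Fin n → ℂ), StrictMono A ∧
      (∀ p q, X p (A q) = if p = q then 1 else 0) ∧ Submodule.span ℂ (Set.range X) = V := by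
  classical
  let e : Fin n → Fin n → ℂ := fun i => Pi.single i 1
  have he : LinearIndependent ℂ e := Pi.linearIndependent_single_one (Fin n) ℂ
  obtain ⟨b, hb, hbf, A, hA, hAV⟩ := pos_lemma he V hV
  have h1 : ∀ p, ∃ x ∈ V, ∃ w ∈ Submodule.span ℂ (e '' {i | i ≤ A p ∧ i ∉ Set.range A}),
      x + w = e (A p) := fun p => Submodule.mem_sup.1 (mem_sup_of_pos he hb hbf hAV (A p))
  choose X hX w hw hXw using h1
  have hw0 : ∀ p q, w p (A q) = 0 := by
    intro p q
    have : Submodule.span ℂ (e '' {i | i ≤ A p ∧ i ∉ Set.range A}) ≤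
        LinearMap.ker (LinearMap.proj (A q) : (Fin n → ℂ) →ₗ[ℂ] ℂ) := by
      refine Submodule.span_le.2 ?_
      rintro _ ⟨i, ⟨-, hi⟩, rfl⟩
      have : A q ≠ i := fun h => hi ⟨q, h⟩
      simp [e, this]
    exact this (hw p)
  have hXA : ∀ p q, X p (A q) = if p = q then 1 else 0 := by
    intro p q
    have := congrFun (hXw p) (A q)
    rw [Pi.add_apply, hw0, add_zero] at this
    rw [this]
    simp [e, Pi.single_apply, hA.injective.eq_iff, eq_comm]
  refine ⟨A, X, hA, hXA, ?_⟩
  have hind : LinearIndependent ℂ X := by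
    apply LinearIndependent.of_comp (LinearMap.funLeft ℂ ℂ A)
    have : (LinearMap.funLeft ℂ ℂ A) ∘ X = fun i => Pi.single i 1 := by
      funext p
      ext q
      simp [LinearMap.funLeft_apply, hXA, Pi.single_apply, eq_comm]
    rw [this]
    exact Pi.linearIndependent_single_one (Fin r) ℂ
  apply Submodule.eq_of_le_of_finrank_eq
  · refine Submodule.span_le.2 ?_
    rintro _ ⟨p, rfl⟩
    exact hX p
  · rw [finrank_span_eq_card hind, Fintype.card_fin, hV]

theorem mem_range_PhiA (I : Fin s → Fin r → Fin n) (f : Fin s → Fin n → Fin n → ℂ) (hf : Frame f)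
    (h : Zp I f) : ∃ (A : Fin r → Fin n) (J : Fin s → Fin r → Fin n), Function.Injective A ∧
      (∀ l, StrictMono (J l)) ∧ (∀ l k, J l k ≤ I l k) ∧ f ∈ Set.range (PhiA A J) := by
  classical
  obtain ⟨V, hV, hVI⟩ := h
  obtain ⟨A, X, hA, hXA, hXV⟩ := exists_chart V hV
  choose b hb hbf J hJ hJV using fun l => pos_lemma (hf l) V hV
  refine ⟨A, J, hA.injective, hJ, fun l k => pos_le (hf l) (hb l) (hbf l) hV (hJ l) (hJV l) k _ (hVI l k), ?_⟩
  let g : Fin s → Fin n → Fin n → Fin n → ℂ := fun l j i =>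
    if i ∈ Set.range (J l) then ∑ p, (if J l p = i then X p else 0)
    else if i ≤ j then f l i else 0
  have hc : ∀ l j, ∃ c : Fin n → ℂ, ∑ i, c i • g l j i = f l j := by
    intro l j
    rw [← Submodule.mem_span_range_iff_exists_fun]
    have h1 := mem_sup_of_pos (hf l) (hb l) (hbf l) (hJV l) j
    refine (sup_le ?_ ?_ : V ⊔ _ ≤ _) h1
    · rw [← hXV]
      refine Submodule.span_le.2 ?_
      rintro _ ⟨p, rfl⟩
      refine Submodule.subset_span ⟨J l p, ?_⟩
      simp only [g, Set.mem_range_self, if_true]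
      rw [Finset.sum_eq_single p]
      · simp
      · intro q _ hq
        have : J l q ≠ J l p := fun h => hq ((hJ l).injective h)
        simp [this]
      · simp
    · refine Submodule.span_mono ?_
      rintro _ ⟨i, ⟨h1, h2⟩, rfl⟩
      exact ⟨i, by simp only [g, if_neg h2, if_pos h1]⟩
  choose c hc using hc
  let z : IdxT A J → ℂ := fun x => match x with
    | .inl y => X y.1.1 y.1.2
    | .inr ⟨l, y⟩ => if y.1.1 ∈ Set.range (J l) then c l y.1.1 y.1.2 else f l y.1.1 y.1.2
  have hX : ∀ p i, Xmat A (fun x => z (.inl x)) p i = X p i := by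
    intro p i
    unfold Xmat
    split_ifs with h1 h2
    · rw [← h2, hXA]; simp
    · obtain ⟨q, rfl⟩ := h1
      rw [hXA]
      have : p ≠ q := fun h => h2 (by rw [h])
      simp [this]
    · rfl
  have hM1 : ∀ l j i, j ∉ Set.range (J l) → Mmat (J l) (fun x => z (.inr ⟨l, x⟩)) j i = f l j i := by
    intro l j i hj
    have : ¬ badL (J l) (j, i) := fun h => hj h.1
    simp only [Mmat, this, not_false_eq_true, dite_true, z, hj, if_false]
  have hM2 : ∀ l j i, j ∈ Set.range (J l) → ¬ badL (J l) (j, i) →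
      Mmat (J l) (fun x => z (.inr ⟨l, x⟩)) j i = c l j i := by
    intro l j i hj hb
    simp only [Mmat, hb, not_false_eq_true, dite_true, z, hj, if_true]
  refine ⟨z, ?_⟩
  funext l j i'
  unfold PhiA
  split_ifs with hj
  · rw [← hc l j, Finset.sum_apply]
    refine Finset.sum_congr rfl (fun i _ => ?_)
    rw [Pi.smul_apply, smul_eq_mul]
    by_cases hi : i ∈ Set.range (J l)
    · have hnb : ¬ badL (J l) (j, i) := fun h => h.2.1 hi
      rw [hM2 l j i hj hnb, if_pos hi]
      simp only [g, if_pos hi, hX, Finset.sum_apply]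
      congr 1
      refine Finset.sum_congr rfl (fun p _ => ?_)
      split_ifs <;> rfl
    · rw [if_neg hi, hM1 l i i' hi]
      by_cases hij : i ≤ j
      · have hnb : ¬ badL (J l) (j, i) := fun h => absurd h.2.2 (not_lt.2 hij)
        rw [hM2 l j i hj hnb]
        simp only [g, if_neg hi, if_pos hij]
      · have hb : badL (J l) (j, i) := ⟨hj, hi, not_le.1 hij⟩
        have hz : Mmat (J l) (fun x => z (.inr ⟨l, x⟩)) j i = 0 := by
          unfold Mmat
          rw [dif_neg (not_not.2 hb)]
        rw [hz]
        simp only [g, if_neg hi, if_neg hij, zero_mul, Pi.zero_apply, mul_zero]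
  · exact hM1 l j i' hj

theorem frame_interior : (interior {f : Fin s → Fin n → Fin n → ℂ | Frame f}).Nonempty := by
  have ho : IsOpen {f : Fin s → Fin n → Fin n → ℂ | Frame f} := by
    have : {f : Fin s → Fin n → Fin n → ℂ | Frame f} = ⋂ l, {f | (Matrix.of (f l)).det ≠ 0} := by
      ext f
      simp only [Set.mem_ofPred_eq, Set.mem_iInter, Frame]
      refine forall_congr' (fun l => ?_)
      have := Matrix.linearIndependent_rows_iff_isUnit (A := Matrix.of (f l))
      rw [Matrix.isUnit_iff_isUnit_det, isUnit_iff_ne_zero] at this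
      exact this
    rw [this]
    refine isOpen_iInter_of_finite (fun l => ?_)
    refine isOpen_ne_fun ?_ continuous_const
    have h1 : Continuous (fun f : Fin s → Fin n → Fin n → ℂ => (Matrix.of (f l) : Matrix (Fin n) (Fin n) ℂ)) :=
      continuous_apply l
    exact h1.matrix_det
  rw [ho.interior_eq]
  exact ⟨fun _ => Pi.basisFun ℂ (Fin n), fun _ => (Pi.basisFun ℂ (Fin n)).linearIndependent⟩

theorem edim_nonneg_of_generic (I : Fin s → Fin r → Fin n)
    (h : ∀ f : Fin s → Fin n → Fin n → ℂ, Frame f → Zp I f) : 0 ≤ edim I := by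
  by_contra hneg
  let ι := {p : (Fin r → Fin n) × (Fin s → Fin r → Fin n) // Function.Injective p.1 ∧
      (∀ l, StrictMono (p.2 l)) ∧ (∀ l k, p.2 l k ≤ I l k)}
  have hsub : {f : Fin s → Fin n → Fin n → ℂ | Frame f} ⊆ ⋃ i : ι, Set.range (PhiA i.1.1 i.1.2) := by
    intro f hf
    obtain ⟨A, J, h1, h2, h3, h4⟩ := mem_range_PhiA I f hf (h f hf)
    exact Set.mem_iUnion.2 ⟨⟨(A, J), h1, h2, h3⟩, h4⟩
  have h1 := dimH_mono hsub
  rw [dimH_iUnion, Real.dimH_of_nonempty_interior frame_interior] at h1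
  have hfin : finrank ℝ (Fin s → Fin n → Fin n → ℂ) = 2 * (s * (n * n)) := by
    simp [Module.finrank_pi_fintype, Complex.finrank_real_complex]
    ring
  have hlt : ∀ i : ι, finrank ℝ (IdxT i.1.1 i.1.2 → ℂ) + 1 ≤ 2 * (s * (n * n)) := by
    rintro ⟨⟨A, J⟩, hA, hJ, hJI⟩
    have h2 := card_IdxT A hA J hJ
    have h3 : edim J ≤ edim I := by
      unfold edim dimI
      gcongr with l _ k _
      exact_mod_cast hJI l k
    have h4 : finrank ℝ (IdxT A J → ℂ) = 2 * Nat.card (IdxT A J) := by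
      classical
      rw [Nat.card_eq_fintype_card]
      rw [Module.finrank_pi_fintype]
      simp only [Complex.finrank_real_complex, Finset.sum_const, Finset.card_univ, smul_eq_mul]
      ring
    simp only
    rw [h4]
    zify
    rw [h2]
    push Not at hneg
    linarith
  rw [hfin] at h1
  have hpos : 1 ≤ 2 * (s * (n * n)) := by
    obtain ⟨A, J, h1, h2, h3, -⟩ := mem_range_PhiA I _ (fun _ => (Pi.basisFun ℂ (Fin n)).linearIndependent)
      (h _ (fun _ => (Pi.basisFun ℂ (Fin n)).linearIndependent))
    have := hlt ⟨(A, J), h1, h2, h3⟩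
    omega
  have h5 : (⨆ i : ι, dimH (Set.range (PhiA i.1.1 i.1.2))) ≤ ((2 * (s * (n * n)) - 1 : ℕ) : ENNReal) := by
    refine iSup_le (fun i => (contDiff_PhiA i.1.1 i.1.2).dimH_range_le.trans ?_)
    have := hlt i
    exact_mod_cast (by omega : finrank ℝ (IdxT i.1.1 i.1.2 → ℂ) ≤ 2 * (s * (n * n)) - 1)
  have h6 := h1.trans h5
  have h7 : 2 * (s * (n * n)) ≤ 2 * (s * (n * n)) - 1 := by exact_mod_cast h6
  omega

end dimcount2

section comp
variable {s d r n : ℕ}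

theorem finrank_map_inj {E F : Type*} [AddCommGroup E] [Module ℂ E] [AddCommGroup F] [Module ℂ F]
    {φ : E →ₗ[ℂ] F} (hφ : Function.Injective φ) (S : Submodule ℂ E) :
    finrank ℂ (S.map φ) = finrank ℂ S := (Submodule.equivMapOfInjective φ hφ S).finrank_eq.symm

theorem comp_generic (I : Fin s → Fin r → Fin n) (J : Fin s → Fin d → Fin r)
    (hI : ∀ f, Frame f → Zp I f) (hJ : ∀ f, Frame f → Zp J f)
    (f : Fin s → Fin n → Fin n → ℂ) (hf : Frame f) : Zp (fun l k => I l (J l k)) f := by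
  obtain ⟨V, hV, hVI⟩ := hI f hf
  choose b hb hbf P hP hPV using fun l => pos_lemma (hf l) V hV
  have hPI : ∀ l k, P l k ≤ I l k := fun l k =>
    pos_le (hf l) (hb l) (hbf l) hV (hP l) (hPV l) k _ (hVI l k)
  let e : V ≃ₗ[ℂ] (Fin r → ℂ) := LinearEquiv.ofFinrankEq _ _ (by simp [hV])
  let φ : (Fin r → ℂ) →ₗ[ℂ] (Fin n → ℂ) := V.subtype ∘ₗ e.symm.toLinearMap
  have hφ : Function.Injective φ := V.injective_subtype.comp e.symm.injective
  let g : Fin s → Fin r → Fin r → ℂ := fun l k => e ⟨b l (P l k), hPV l k⟩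
  have hg : ∀ l k, φ (g l k) = b l (P l k) := fun l k => by simp [φ, g]
  have hgF : Frame g := by
    intro l
    have : LinearIndependent ℂ (φ ∘ g l) := by
      have e1 : φ ∘ g l = b l ∘ P l := funext (hg l)
      rw [e1]
      exact (hb l).comp _ (hP l).injective
    exact LinearIndependent.of_comp φ this
  obtain ⟨S, hS, hSJ⟩ := hJ g hgF
  refine ⟨S.map φ, by rw [finrank_map_inj hφ, hS], fun l k => ?_⟩
  refine (hSJ l k).trans ?_
  rw [← finrank_map_inj hφ]
  apply Submodule.finrank_mono
  refine (Submodule.map_inf_le φ).trans (inf_le_inf_left _ ?_)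
  rw [Fsp, Submodule.map_span, Submodule.span_le]
  rintro _ ⟨_, ⟨i, hi, rfl⟩, rfl⟩
  rw [hg]
  exact Fsp_mono _ (((hP l).monotone hi).trans (hPI l _)) (hbf l (P l i))

end comp

section chi
variable {s d r q : ℕ}

/-- The expected dimension for a pattern. -/
def ed (q : ℕ) (a : Fin s → Fin d → ℕ) : ℤ := d * q - ∑ l, ∑ k, ((q : ℤ) - a l k)

theorem sm_gap {n : ℕ} {I : Fin r → Fin n} (hI : StrictMono I) :
    ∀ (t : ℕ) (i j : Fin r), (j : ℕ) = i + t → t + (I i : ℕ) ≤ I j := by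
  intro t
  induction t with
  | zero =>
    intro i j h
    have : i = j := Fin.ext (by omega)
    subst this; omega
  | succ t ih =>
    intro i j h
    have h1 := ih i ⟨i + t, by omega⟩ rfl
    have h2 : I ⟨i + t, by omega⟩ < I j := hI (by rw [Fin.lt_def]; simp; omega)
    rw [Fin.lt_def] at h2
    omega

theorem sm_mono {n : ℕ} {I : Fin r → Fin n} (hI : StrictMono I) :
    Monotone (fun j => (I j : ℕ) - j) := by
  intro i j h
  have h' : (i : ℕ) ≤ j := h
  have := sm_gap hI (j - i) i j (by omega)
  simp only
  omega

theorem sm_ge {n : ℕ} {I : Fin r → Fin n} (hI : StrictMono I) (j : Fin r) : (j : ℕ) ≤ I j := by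
  have := sm_gap hI j ⟨0, by have := j.2; omega⟩ j (by simp)
  omega

theorem sm_le {n : ℕ} {I : Fin r → Fin n} (hI : StrictMono I) (j : Fin r) :
    (I j : ℕ) - j ≤ n - r := by
  have := sm_gap hI (r - 1 - j) j ⟨r - 1, by have := j.2; omega⟩ (by simp; omega)
  omega

theorem ed_comp {n : ℕ} (I : Fin s → Fin r → Fin n) (hI : ∀ l, StrictMono (I l)) (hrn : r ≤ n)
    (J : Fin s → Fin d → Fin r) :
    ed (n - r) (fun l k => (I l (J l k) : ℕ) - (J l k : ℕ)) =
      edim (fun l k => I l (J l k)) - edim J := by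
  have h1 : ∀ l k, (((I l (J l k) : ℕ) - (J l k : ℕ) : ℕ) : ℤ) = (I l (J l k) : ℕ) - (J l k : ℕ) :=
    fun l k => Nat.cast_sub (sm_ge (hI l) _)
  unfold ed edim dimI
  simp only [h1, Nat.cast_sub hrn, Finset.sum_sub_distrib, Finset.sum_const, Finset.card_univ,
    Fintype.card_fin, nsmul_eq_mul]
  ring

/-- Steps of the filtration. -/
def Wsp {m : ℕ} {E : Type*} [AddCommGroup E] [Module ℂ E] (a : Fin m → ℕ) (f : Fin m → E) (c : ℕ) :
    Submodule ℂ E := Submodule.span ℂ (f '' {j | a j ≤ c})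

noncomputable def chi {E : Type*} [AddCommGroup E] [Module ℂ E] (q : ℕ) (a : Fin s → Fin r → ℕ)
    (f : Fin s → Fin r → E) (S : Submodule ℂ E) : ℤ :=
  q * finrank ℂ S - ∑ l, ∑ c ∈ Finset.range q, (finrank ℂ ↥(S ⊓ Wsp (a l) (f l) c) : ℤ)

theorem lower_a {a : Fin r → ℕ} (ha : Monotone a) (c : ℕ) : IsLowerSet {j | a j ≤ c} :=
  fun _ _ h h2 => (ha h).trans h2

theorem count_a (q : ℕ) (a : Fin d → ℕ) (ha : ∀ k, a k ≤ q) :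
    ∑ c ∈ Finset.range q, ((Finset.univ.filter (fun k => a k ≤ c)).card : ℤ) =
      ∑ k, ((q : ℤ) - a k) := by
  simp only [Finset.card_filter, Nat.cast_sum]
  rw [Finset.sum_comm]
  refine Finset.sum_congr rfl fun k _ => ?_
  rw [← Nat.cast_sum, ← Finset.card_filter]
  have : Finset.filter (fun c => a k ≤ c) (Finset.range q) = Finset.Ico (a k) q := by
    ext c; simp; omega
  rw [this, Nat.card_Ico, Nat.cast_sub (ha k)]

theorem chi_eq {a : Fin s → Fin r → ℕ} (ha : ∀ l, Monotone (a l)) (haq : ∀ l j, a l j ≤ q)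
    {f b : Fin s → Fin r → Fin r → ℂ} (hf : Frame f) (hb : Frame b)
    (hbf : ∀ l j, b l j ∈ Fsp (f l) j)
    {S : Submodule ℂ (Fin r → ℂ)} (hd : finrank ℂ S = d) {J : Fin s → Fin d → Fin r}
    (hJ : ∀ l, StrictMono (J l)) (hbS : ∀ l k, b l (J l k) ∈ S) :
    chi q a f S = ed q (fun l k => a l (J l k)) := by
  unfold chi ed
  rw [hd]
  congr 1
  · ring
  refine Finset.sum_congr rfl fun l _ => ?_
  rw [← count_a q (fun k => a l (J l k)) (fun k => haq _ _)]
  refine Finset.sum_congr rfl fun c _ => ?_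
  rw [Wsp, ← span_lower_eq (hf l) (hb l) (hbf l) (lower_a (ha l) c),
    pos_dim (hb l) hd (hJ l).injective (hbS l)]
  rfl

theorem chi_le {a : Fin s → Fin r → ℕ} (ha : ∀ l, Monotone (a l)) (haq : ∀ l j, a l j ≤ q)
    {f : Fin s → Fin r → Fin r → ℂ} (hf : Frame f)
    {S : Submodule ℂ (Fin r → ℂ)} (hd : finrank ℂ S = d) {J : Fin s → Fin d → Fin r}
    (hS : ∀ (l : Fin s) (k : Fin d), (k : ℕ) + 1 ≤ finrank ℂ ↥(S ⊓ Fsp (f l) (J l k))) :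
    chi q a f S ≤ ed q (fun l k => a l (J l k)) := by
  choose b hb hbf P hP hPV using fun l => pos_lemma (hf l) S hd
  rw [chi_eq ha haq hf hb hbf hd hP hPV]
  unfold ed
  refine sub_le_sub_left (Finset.sum_le_sum fun l _ => Finset.sum_le_sum fun k _ => ?_) _
  have := ha l (pos_le (hf l) (hb l) (hbf l) hd (hP l) (hPV l) k _ (hS l k))
  simp only
  omega

def SS (q : ℕ) (a : Fin s → Fin r → ℕ) (f : Fin s → Fin r → Fin r → ℂ) : Prop :=
  Frame f ∧ ∀ S, 0 ≤ chi q a f S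

theorem pos_Zp {f b : Fin r → Fin r → ℂ} (hf : LinearIndependent ℂ f) (hb : LinearIndependent ℂ b)
    (hbf : ∀ j, b j ∈ Fsp f j)
    {S : Submodule ℂ (Fin r → ℂ)} (hd : finrank ℂ S = d) {J : Fin d → Fin r}
    (hJ : StrictMono J) (hbS : ∀ k, b (J k) ∈ S) (k : Fin d) :
    (k : ℕ) + 1 ≤ finrank ℂ ↥(S ⊓ Fsp f (J k)) := by
  classical
  rw [← Fsp_eq_of_mem hf hb hbf, Fsp, pos_dim hb hd hJ.injective hbS]
  rw [← Fin.card_Iic]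
  apply Finset.card_le_card
  intro i hi
  simp only [Finset.mem_filter, Finset.mem_univ, true_and, Set.mem_Iic]
  exact hJ.monotone (Finset.mem_Iic.1 hi)

theorem SS_lineOpen {a : Fin s → Fin r → ℕ} (ha : ∀ l, Monotone (a l)) (haq : ∀ l j, a l j ≤ q) :
    LineOpen (SS q a : (Fin s → Fin r → Fin r → ℂ) → Prop) := by
  have h1 := Frame_lineOpen (s := s) (r := r) |>.and (LineOpen.forall_fin
    (ι := Σ d : Fin (r + 1), {J : Fin s → Fin d → Fin r // ed q (fun l k => a l (J l k)) < 0})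
    (fun i => ZL1 i.2.1))
  have e : (SS q a : (Fin s → Fin r → Fin r → ℂ) → Prop) = fun f => (Frame f ∧ ∀ i : Σ d : Fin (r + 1),
      {J : Fin s → Fin d → Fin r // ed q (fun l k => a l (J l k)) < 0}, Frame f ∧ ¬ Zp i.2.1 f) := by
    funext f
    apply propext
    constructor
    · rintro ⟨hf, h⟩
      refine ⟨hf, fun i => ⟨hf, ?_⟩⟩
      rintro ⟨S, hS, hSk⟩
      have := chi_le ha haq hf hS hSk
      have h2 := i.2.2
      have := h S
      omega
    · rintro ⟨hf, h⟩
      refine ⟨hf, fun S => ?_⟩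
      by_contra hcon
      have hd : finrank ℂ S < r + 1 := by
        have := S.finrank_le
        simp at this; omega
      choose b hb hbf P hP hPV using fun l => pos_lemma (hf l) S rfl
      have hc := chi_eq ha haq hf hb hbf rfl hP hPV
      refine (h ⟨⟨_, hd⟩, P, by rw [← hc]; omega⟩).2 ?_
      exact ⟨S, rfl, fun l k => pos_Zp (hf l) (hb l) (hbf l) rfl (hP l) (hPV l) k⟩
  rw [e]
  exact h1

end chi

section hnlem
variable {E F : Type*} [AddCommGroup E] [Module ℂ E] [AddCommGroup F] [Module ℂ F]
  [FiniteDimensional ℂ E]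

theorem rn_map (φ : E →ₗ[ℂ] F) (X : Submodule ℂ E) :
    finrank ℂ (X.map φ) + finrank ℂ ↥(X ⊓ LinearMap.ker φ) = finrank ℂ X := by
  have := LinearMap.finrank_range_add_finrank_ker (φ.domRestrict X)
  rw [LinearMap.range_domRestrict] at this
  rw [← this]
  congr 1
  rw [LinearMap.ker_domRestrict, ← finrank_map_inj X.injective_subtype]
  rw [Submodule.map_comap_subtype]

theorem hn_ineq (S W : Submodule ℂ E) (u : S →ₗ[ℂ] E ⧸ S)
    (h : ∀ x : S, (x : E) ∈ W → u x ∈ W.map S.mkQ) :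
    2 * finrank ℂ ↥(S ⊓ W) ≤ finrank ℂ ↥((LinearMap.range u).comap S.mkQ ⊓ W) +
      finrank ℂ ↥((LinearMap.ker u).map S.subtype ⊓ W) := by
  set T := (LinearMap.range u).comap S.mkQ
  have hST : S ≤ T := by
    conv_lhs => rw [← Submodule.ker_mkQ S]
    exact LinearMap.ker_le_comap _
  have h1 := rn_map u (W.comap S.subtype)
  have h2 := rn_map S.mkQ (T ⊓ W)
  have h3 : finrank ℂ ↥(W.comap S.subtype) = finrank ℂ ↥(S ⊓ W) := by
    rw [← finrank_map_inj S.injective_subtype, Submodule.map_comap_subtype]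
  have h4 : finrank ℂ ↥(W.comap S.subtype ⊓ LinearMap.ker u) ≤
      finrank ℂ ↥((LinearMap.ker u).map S.subtype ⊓ W) := by
    rw [← finrank_map_inj S.injective_subtype]
    apply Submodule.finrank_mono
    rintro _ ⟨x, ⟨hx1, hx2⟩, rfl⟩
    exact ⟨⟨x, hx2, rfl⟩, hx1⟩
  have h5 : finrank ℂ ↥((W.comap S.subtype).map u) ≤ finrank ℂ ↥((T ⊓ W).map S.mkQ) := by
    apply Submodule.finrank_mono
    rintro _ ⟨x, hx, rfl⟩
    obtain ⟨w, hw, hw2⟩ := h x hx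
    exact ⟨w, ⟨⟨x, hw2.symm⟩, hw⟩, hw2⟩
  have h6 : finrank ℂ ↥(S ⊓ W) ≤ finrank ℂ ↥(T ⊓ W ⊓ LinearMap.ker S.mkQ) := by
    apply Submodule.finrank_mono
    rw [Submodule.ker_mkQ]
    exact le_inf (inf_le_inf_right _ hST) inf_le_left
  omega

theorem hn_dim (S : Submodule ℂ E) (u : S →ₗ[ℂ] E ⧸ S) :
    finrank ℂ ((LinearMap.range u).comap S.mkQ) = finrank ℂ S + finrank ℂ (LinearMap.range u) ∧
    finrank ℂ ((LinearMap.ker u).map S.subtype) + finrank ℂ (LinearMap.range u) = finrank ℂ S := by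
  set T := (LinearMap.range u).comap S.mkQ with hT
  have hST : S ≤ T := by
    conv_lhs => rw [← Submodule.ker_mkQ S]
    exact LinearMap.ker_le_comap _
  constructor
  · have h2 := rn_map S.mkQ T
    rw [Submodule.ker_mkQ, inf_eq_right.2 hST, hT,
      Submodule.map_comap_eq_of_surjective S.mkQ_surjective] at h2
    rw [← h2, add_comm]
  · rw [finrank_map_inj S.injective_subtype, add_comm]
    exact LinearMap.finrank_range_add_finrank_ker u

theorem hn_chi {s r : ℕ} (q : ℕ) (a : Fin s → Fin r → ℕ) (f : Fin s → Fin r → E)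
    (S : Submodule ℂ E) (hmin : ∀ T, chi q a f S ≤ chi q a f T)
    (hmax : ∀ T, chi q a f T = chi q a f S → finrank ℂ T ≤ finrank ℂ S)
    (u : S →ₗ[ℂ] E ⧸ S)
    (h : ∀ l c, ∀ x : S, (x : E) ∈ Wsp (a l) (f l) c → u x ∈ (Wsp (a l) (f l) c).map S.mkQ) :
    u = 0 := by
  obtain ⟨h1, h2⟩ := hn_dim S u
  set T := (LinearMap.range u).comap S.mkQ
  set K := (LinearMap.ker u).map S.subtype
  have h3 : chi q a f T + chi q a f K ≤ 2 * chi q a f S := by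
    have h4 : ∀ l, ∀ c ∈ Finset.range q, 2 * (finrank ℂ ↥(S ⊓ Wsp (a l) (f l) c) : ℤ) ≤
       (finrank ℂ ↥(T ⊓ Wsp (a l) (f l) c) : ℤ) + (finrank ℂ ↥(K ⊓ Wsp (a l) (f l) c) : ℤ) :=
      fun l c _ => by exact_mod_cast hn_ineq S _ u (h l c)
    have h5 := Finset.sum_le_sum fun l (_ : l ∈ Finset.univ) => Finset.sum_le_sum (h4 l)
    simp only [Finset.sum_add_distrib, ← Finset.mul_sum] at h5
    have h6 : (finrank ℂ T : ℤ) + finrank ℂ K = 2 * finrank ℂ S := by omega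
    unfold chi
    have h7 : (q : ℤ) * finrank ℂ T + q * finrank ℂ K = 2 * (q * finrank ℂ S) := by
      rw [← mul_add, h6]; ring
    linarith
  have h4 : finrank ℂ T ≤ finrank ℂ S := hmax T (le_antisymm (by linarith [hmin K]) (hmin T))
  have h5 : finrank ℂ (LinearMap.range u) = 0 := by omega
  rw [Submodule.finrank_eq_zero] at h5
  exact LinearMap.range_eq_bot.1 h5
end hnlem

theorem exists_hom_ne_zero {S Q ι : Type*} [AddCommGroup S] [Module ℂ S] [AddCommGroup Q]
    [Module ℂ Q] [FiniteDimensional ℂ S] [FiniteDimensional ℂ Q] [Fintype ι] (x : ι → S)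
    (N : ι → Submodule ℂ Q) (h : ∑ p, finrank ℂ (Q ⧸ N p) < finrank ℂ S * finrank ℂ Q) :
    ∃ u : S →ₗ[ℂ] Q, u ≠ 0 ∧ ∀ p, u (x p) ∈ N p := by
  classical
  let Ψ : (S →ₗ[ℂ] Q) →ₗ[ℂ] (∀ p, Q ⧸ N p) :=
    LinearMap.pi (fun p => (N p).mkQ ∘ₗ LinearMap.applyₗ (x p))
  have hker : LinearMap.ker Ψ ≠ ⊥ := by
    apply LinearMap.ker_ne_bot_of_finrank_lt
    rw [Module.finrank_pi_fintype, Module.finrank_linearMap]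
    exact h
  obtain ⟨u, hu, hu0⟩ := Submodule.exists_mem_ne_zero_of_ne_bot hker
  refine ⟨u, hu0, fun p => ?_⟩
  exact (Submodule.Quotient.mk_eq_zero _).1 (congrFun (LinearMap.mem_ker.1 hu) p)

section B1
variable {s d r q : ℕ}

theorem exists_u {f b : Fin s → Fin r → Fin r → ℂ} (hf : Frame f) (hb : Frame b)
    (hbf : ∀ l j, b l j ∈ Fsp (f l) j)
    {S : Submodule ℂ (Fin r → ℂ)} (hd : finrank ℂ S = d) {J : Fin s → Fin d → Fin r}
    (hJ : ∀ l, StrictMono (J l)) (hbS : ∀ l k, b l (J l k) ∈ S) (he : 0 < edim J) :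
    ∃ u : S →ₗ[ℂ] (Fin r → ℂ) ⧸ S, u ≠ 0 ∧
      ∀ l k, u ⟨b l (J l k), hbS l k⟩ ∈ (Fsp (f l) (J l k)).map S.mkQ := by
  classical
  let N : Fin s × Fin d → Submodule ℂ ((Fin r → ℂ) ⧸ S) := fun p => (Fsp (f p.1) (J p.1 p.2)).map S.mkQ
  have hQ : finrank ℂ ((Fin r → ℂ) ⧸ S) + d = r := by
    have := S.finrank_quotient_add_finrank
    rw [hd] at this; simpa using this
  have hN : ∀ p, finrank ℂ (N p) + p.2 = J p.1 p.2 := by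
    rintro ⟨l, k⟩
    have h1 := rn_map S.mkQ (Fsp (f l) (J l k))
    rw [Submodule.ker_mkQ, Fsp_finrank (hf l), inf_comm, ← Fsp_eq_of_mem (hf l) (hb l) (hbf l), Fsp,
      pos_dim (hb l) hd (hJ l).injective (hbS l)] at h1
    have h2 : (Finset.univ.filter (fun k' => J l k' ∈ Set.Iic (J l k))) = Finset.Iic k := by
      ext k'
      simp [(hJ l).le_iff_le]
    rw [h2, Fin.card_Iic] at h1
    have h3 : N (l, k) = (Submodule.span ℂ (b l '' Set.Iic (J l k))).map S.mkQ := by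
      show (Fsp (f l) (J l k)).map S.mkQ = _
      rw [← Fsp_eq_of_mem (hf l) (hb l) (hbf l), Fsp]
    rw [h3]
    simp only
    omega
  obtain ⟨u, hu0, hu⟩ := exists_hom_ne_zero (fun p : Fin s × Fin d =>
      (⟨b p.1 (J p.1 p.2), hbS p.1 p.2⟩ : S)) N (by
    rw [hd]
    have h1 : ∀ p, (finrank ℂ (((Fin r → ℂ) ⧸ S) ⧸ N p) : ℤ) = (r - d) - (J p.1 p.2 - p.2) := by
      intro p
      have := (N p).finrank_quotient_add_finrank
      have := hN p
      omega
    zify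
    have h2 : (finrank ℂ ((Fin r → ℂ) ⧸ S) : ℤ) = r - d := by omega
    simp only [h1, h2]
    unfold edim dimI at he
    rw [Fintype.sum_prod_type]
    simp only [Finset.sum_sub_distrib, Finset.sum_const, Finset.card_univ,
      Fintype.card_fin, nsmul_eq_mul] at he ⊢
    linarith)
  exact ⟨u, hu0, fun l k => hu (l, k)⟩

theorem pos_inf {b : Fin r → Fin r → ℂ} (hb : LinearIndependent ℂ b)
    {S : Submodule ℂ (Fin r → ℂ)} (hd : finrank ℂ S = d) {J : Fin d → Fin r}
    (hJ : Function.Injective J) (hbS : ∀ k, b (J k) ∈ S) (A : Set (Fin r)) :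
    S ⊓ Submodule.span ℂ (b '' A) = Submodule.span ℂ (b '' (Set.range J ∩ A)) := by
  let B := basisOfLinearIndependentOfCardEqFinrank' b hb (by simp)
  have hB : ⇑B = b := by simp [B]
  conv_lhs => rw [← pos_span hb hd hJ hbS]
  ext x
  rw [Submodule.mem_inf, ← hB, B.mem_span_image, B.mem_span_image, B.mem_span_image,
      ← Set.subset_inter_iff]

theorem exists_min_chi (q : ℕ) (a : Fin s → Fin r → ℕ) (f : Fin s → Fin r → Fin r → ℂ) :
    ∃ S : Submodule ℂ (Fin r → ℂ), (∀ T, chi q a f S ≤ chi q a f T) ∧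
        (∀ T, chi q a f T = chi q a f S → finrank ℂ T ≤ finrank ℂ S) := by
  have hle : ∀ S : Submodule ℂ (Fin r → ℂ), (finrank ℂ S : ℤ) ≤ r := by
    intro S
    have := S.finrank_le
    rw [Module.finrank_fin_fun] at this
    exact_mod_cast this
  have hb : ∀ S : Submodule ℂ (Fin r → ℂ), -((s : ℤ) * (q * r)) ≤ chi q a f S := by
    intro S
    unfold chi
    have h1 : ∑ l : Fin s, ∑ c ∈ Finset.range q, (finrank ℂ ↥(S ⊓ Wsp (a l) (f l) c) : ℤ) ≤
        ∑ l : Fin s, ∑ c ∈ Finset.range q, (r : ℤ) :=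
      Finset.sum_le_sum fun l _ => Finset.sum_le_sum fun c _ => hle _
    simp only [Finset.sum_const, Finset.card_univ, Fintype.card_fin, Finset.card_range,
      nsmul_eq_mul] at h1
    have h2 : (0 : ℤ) ≤ q * finrank ℂ S := by positivity
    linarith
  obtain ⟨m, ⟨S, hS⟩, hm⟩ := Int.exists_least_of_bdd
    (P := fun z => ∃ S : Submodule ℂ (Fin r → ℂ), chi q a f S * (r + 1) - finrank ℂ S = z)
    ⟨-((s : ℤ) * (q * r)) * (r + 1) - r, by
      rintro z ⟨S, rfl⟩
      have h1 := hle S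
      have h2 := mul_le_mul_of_nonneg_right (hb S) (show (0 : ℤ) ≤ r + 1 by positivity)
      linarith⟩ ⟨_, ⊥, rfl⟩
  have hm2 : ∀ T, chi q a f S * (r + 1) - finrank ℂ S ≤ chi q a f T * (r + 1) - finrank ℂ T :=
    fun T => by rw [hS]; exact hm _ ⟨T, rfl⟩
  refine ⟨S, fun T => ?_, fun T hT => ?_⟩
  · by_contra hc
    have h1 : chi q a f T ≤ chi q a f S - 1 := by omega
    have h2 := mul_le_mul_of_nonneg_right h1 (show (0 : ℤ) ≤ r + 1 by positivity)
    have h3 := hm2 T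
    have h4 := hle S
    linarith
  · have := hm2 T
    rw [hT] at this
    omega

theorem exists_SS {a : Fin s → Fin r → ℕ} (ha : ∀ l, Monotone (a l)) (haq : ∀ l j, a l j ≤ q)
    (h0 : 0 ≤ ed q a)
    (h : ∀ d, 1 ≤ d → d < r → ∀ J : Fin s → Fin d → Fin r, (∀ l, StrictMono (J l)) →
      (∀ f, Frame f → Zp J f) → edim J = 0 → 0 ≤ ed q (fun l k => a l (J l k))) :
    ∃ f : Fin s → Fin r → Fin r → ℂ, SS q a f := by
  by_contra hcon
  push Not at hcon
  let ι := Σ d : Fin (r + 1), {J : Fin s → Fin d → Fin r // (1 ≤ (d : ℕ) ∧ (d : ℕ) < r) ∧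
    (∀ l, StrictMono (J l)) ∧ edim J ≤ 0 ∧ ed q (fun l k => a l (J l k)) < 0}
  obtain ⟨⟨d, J, hd, hJ, he, hed⟩, hi⟩ := exists_generic (ι := ι) (fun i => i.2.1) (by
    intro f hf
    have hne : ∃ S : Submodule ℂ (Fin r → ℂ), chi q a f S < 0 := by
      by_contra hc
      push Not at hc
      exact hcon f ⟨hf, hc⟩
    obtain ⟨S, hmin, hmax⟩ : ∃ S : Submodule ℂ (Fin r → ℂ), (∀ T, chi q a f S ≤ chi q a f T) ∧
        (∀ T, chi q a f T = chi q a f S → finrank ℂ T ≤ finrank ℂ S) := exists_min_chi q a f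
    have hneg : chi q a f S < 0 := by
      obtain ⟨T, hT⟩ := hne
      exact (hmin T).trans_lt hT
    have hd : finrank ℂ S < r + 1 := by
      have := S.finrank_le
      simp at this; omega
    choose b hb hbf P hP hPV using fun l => pos_lemma (hf l) S rfl
    have hc := chi_eq ha haq hf hb hbf rfl hP hPV
    have hd1 : 1 ≤ finrank ℂ S := by
      by_contra h0
      have : S = ⊥ := Submodule.finrank_eq_zero.1 (by omega)
      subst this
      have hz : ∀ X : Submodule ℂ (Fin r → ℂ), finrank ℂ ↥(⊥ ⊓ X) = 0 := by
        intro X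
        rw [bot_inf_eq, finrank_bot]
      simp [chi, hz] at hneg
    have hd2 : finrank ℂ S < r := by
      by_contra h1
      have : S = ⊤ := Submodule.eq_top_of_finrank_eq (by simp; omega)
      subst this
      have h2 := chi_eq ha haq hf hf (fun l j => mem_Fsp _ le_rfl) (d := r) (by simp)
        (J := fun l => id) (fun l => strictMono_id) (S := ⊤) (by simp)
      change _ = ed q a at h2
      omega
    refine ⟨⟨⟨finrank ℂ S, hd⟩, P, ⟨hd1, hd2⟩, hP, ?_, by rw [← hc]; exact hneg⟩, ?_⟩
    · by_contra he
      obtain ⟨u, hu0, hu⟩ := exists_u hf hb hbf rfl hP hPV (not_le.1 he)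
      apply hu0
      apply hn_chi q a f S hmin hmax
      intro l c x hx
      have hx2 : (x : Fin r → ℂ) ∈ S ⊓ Submodule.span ℂ (b l '' {j | a l j ≤ c}) := by
        rw [span_lower_eq (hf l) (hb l) (hbf l) (lower_a (ha l) c)]
        exact ⟨x.2, hx⟩
      rw [pos_inf (hb l) rfl (hP l).injective (hPV l)] at hx2
      have hx3 : x ∈ Submodule.span ℂ ((fun k => (⟨b l (P l k), hPV l k⟩ : S)) '' {k | a l (P l k) ≤ c}) := by
        have hm : S.subtype x ∈ Submodule.map S.subtype (Submodule.span ℂ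
            ((fun k => (⟨b l (P l k), hPV l k⟩ : S)) '' {k | a l (P l k) ≤ c})) := by
          rw [Submodule.map_span]
          refine Submodule.span_mono ?_ hx2
          rintro _ ⟨_, ⟨⟨k, rfl⟩, hk⟩, rfl⟩
          exact ⟨_, ⟨k, hk, rfl⟩, rfl⟩
        obtain ⟨y, hy, hxy⟩ := hm
        rwa [S.injective_subtype hxy] at hy
      have hx4 : u x ∈ Submodule.map u _ := ⟨x, hx3, rfl⟩
      rw [Submodule.map_span] at hx4
      refine Submodule.span_le.2 ?_ hx4
      rintro _ ⟨_, ⟨k, hk, rfl⟩, rfl⟩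
      refine Submodule.map_mono ?_ (hu l k)
      refine Submodule.span_mono (Set.image_mono ?_)
      intro j hj
      exact (ha l hj).trans hk
    · exact ⟨S, rfl, fun l k => pos_Zp (hf l) (hb l) (hbf l) rfl (hP l) (hPV l) k⟩)
  have h1 := edim_nonneg_of_generic _ hi
  have := h d hd.1 hd.2 J hJ hi (le_antisymm he h1)
  omega
end B1

section surj
variable {s d r q : ℕ}

def Gs {q : ℕ} {E : Type*} [AddCommGroup E] [Module ℂ E] (g : Fin q → E) (c : ℕ) : Submodule ℂ E :=
  Submodule.span ℂ (g '' {i | (i : ℕ) < c})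

theorem Gs_mono {E : Type*} [AddCommGroup E] [Module ℂ E] (g : Fin q → E) {c c' : ℕ} (h : c ≤ c') :
    Gs g c ≤ Gs g c' :=
  Submodule.span_mono (Set.image_mono (fun i (hi : (i : ℕ) < c) => (hi.trans_le h : (i : ℕ) < c')))

theorem Gs_finrank {E : Type*} [AddCommGroup E] [Module ℂ E] {g : Fin q → E}
    (hg : LinearIndependent ℂ g) {c : ℕ} (hc : c ≤ q) : finrank ℂ (Gs g c) = c := by
  classical
  have h := finrank_span_image hg (Finset.univ.filter (fun i : Fin q => (i : ℕ) < c))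
  have e : ((Finset.univ.filter (fun i : Fin q => (i : ℕ) < c) : Finset (Fin q)) : Set (Fin q)) =
      {i : Fin q | (i : ℕ) < c} := by ext; simp
  rw [e] at h
  rw [Gs, h, Fin.card_filter_val_lt]
  simp [hc]

theorem mem_Gs_iff {E : Type*} [AddCommGroup E] [Module ℂ E] (g : Fin q → E) (c : ℕ) (x : E) :
    x ∈ Gs g c ↔ ∃ T : Fin q → ℂ, ∑ i : Fin q, (if (i : ℕ) < c then T i else 0) • g i = x := by
  classical
  constructor
  · intro hx
    refine Submodule.span_induction ?_ ?_ ?_ ?_ hx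
    · rintro _ ⟨i, hi, rfl⟩
      refine ⟨Pi.single i 1, ?_⟩
      rw [Finset.sum_eq_single i]
      · simp [show (i : ℕ) < c from hi]
      · intro j _ hj
        simp [Pi.single_eq_of_ne hj]
      · simp
    · exact ⟨0, by simp⟩
    · rintro _ _ _ _ ⟨T, rfl⟩ ⟨T', rfl⟩
      refine ⟨T + T', ?_⟩
      rw [← Finset.sum_add_distrib]
      refine Finset.sum_congr rfl fun i _ => ?_
      split_ifs <;> simp [add_smul]
    · rintro m _ _ ⟨T, rfl⟩
      refine ⟨m • T, ?_⟩
      rw [Finset.smul_sum]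
      refine Finset.sum_congr rfl fun i _ => ?_
      split_ifs <;> simp [mul_smul]
  · rintro ⟨T, rfl⟩
    refine Submodule.sum_mem _ fun i _ => ?_
    split_ifs with h
    · exact Submodule.smul_mem _ _ (Submodule.subset_span ⟨i, h, rfl⟩)
    · rw [zero_smul]; exact zero_mem _

def Surj (a : Fin s → Fin r → ℕ) (f : Fin s → Fin r → Fin r → ℂ) (g : Fin s → Fin q → Fin q → ℂ) :
    Prop :=
  ∀ α : Fin s → Fin r → Fin q → ℂ, ∃ A : (Fin r → ℂ) →ₗ[ℂ] (Fin q → ℂ),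
    ∀ l j, α l j - A (f l j) ∈ Gs (g l) (a l j)

def Lm (a : Fin s → Fin r → ℕ) (f : Fin s → Fin r → Fin r → ℂ) (g : Fin s → Fin q → Fin q → ℂ) :
    (((Fin r → ℂ) →ₗ[ℂ] (Fin q → ℂ)) × (Fin s → Fin r → Fin q → ℂ)) →ₗ[ℂ]
      (Fin s → Fin r → Fin q → ℂ) where
  toFun x := fun l j => x.1 (f l j) + ∑ i : Fin q, (if (i : ℕ) < a l j then x.2 l j i else 0) • g l i
  map_add' x y := by
    funext l j
    simp only [Prod.fst_add, Prod.snd_add, LinearMap.add_apply, Pi.add_apply]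
    rw [add_add_add_comm, ← Finset.sum_add_distrib]
    congr 1
    refine Finset.sum_congr rfl fun i _ => ?_
    split_ifs <;> simp [add_smul]
  map_smul' c x := by
    funext l j
    simp only [Prod.smul_fst, Prod.smul_snd, LinearMap.smul_apply, Pi.smul_apply, RingHom.id_apply,
      smul_add, Finset.smul_sum]
    congr 1
    refine Finset.sum_congr rfl fun i _ => ?_
    split_ifs <;> simp [mul_smul]

theorem Lm_line (a : Fin s → Fin r → ℕ) (f f' : Fin s → Fin r → Fin r → ℂ)
    (g g' : Fin s → Fin q → Fin q → ℂ) (t : ℂ) :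
    Lm a (f + t • f') (g + t • g') = Lm a f g + t • Lm a f' g' := by
  refine LinearMap.ext fun x => ?_
  funext l j
  simp only [Lm, LinearMap.coe_mk, AddHom.coe_mk, LinearMap.add_apply, LinearMap.smul_apply,
    Pi.add_apply, Pi.smul_apply, map_add, map_smul, smul_add, Finset.sum_add_distrib, Finset.smul_sum]
  rw [add_add_add_comm]
  congr 2
  refine Finset.sum_congr rfl fun i _ => ?_
  rw [smul_comm]

theorem mem_range_Lm (a : Fin s → Fin r → ℕ) (f : Fin s → Fin r → Fin r → ℂ)
    (g : Fin s → Fin q → Fin q → ℂ) (α : Fin s → Fin r → Fin q → ℂ) :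
    α ∈ LinearMap.range (Lm a f g) ↔ ∃ A : (Fin r → ℂ) →ₗ[ℂ] (Fin q → ℂ),
      ∀ l j, α l j - A (f l j) ∈ Gs (g l) (a l j) := by
  constructor
  · rintro ⟨⟨A, T⟩, rfl⟩
    refine ⟨A, fun l j => (mem_Gs_iff _ _ _).2 ⟨T l j, ?_⟩⟩
    simp [Lm]
  · rintro ⟨A, h⟩
    choose T hT using fun l j => (mem_Gs_iff _ _ _).1 (h l j)
    refine ⟨(A, T), ?_⟩
    funext l j
    simp only [Lm, LinearMap.coe_mk, AddHom.coe_mk, hT]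
    abel

theorem surj_iff (a : Fin s → Fin r → ℕ) (f : Fin s → Fin r → Fin r → ℂ)
    (g : Fin s → Fin q → Fin q → ℂ) :
    Surj a f g ↔ finrank ℂ (Fin s → Fin r → Fin q → ℂ) ≤ finrank ℂ (LinearMap.range (Lm a f g)) := by
  constructor
  · intro h
    have : LinearMap.range (Lm a f g) = ⊤ := by
      rw [eq_top_iff]
      intro α _
      exact (mem_range_Lm a f g α).2 (h α)
    rw [this, finrank_top]
  · intro h α
    rw [← mem_range_Lm]
    have : LinearMap.range (Lm a f g) = ⊤ :=
      Submodule.eq_top_of_finrank_eq (le_antisymm (Submodule.finrank_le _) h)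
    rw [this]
    trivial

theorem rank_lineOpen (a : Fin s → Fin r → ℕ) (m : ℕ) :
    LineOpen (fun x : (Fin s → Fin r → Fin r → ℂ) × (Fin s → Fin q → Fin q → ℂ) =>
      m ≤ finrank ℂ (LinearMap.range (Lm a x.1 x.2))) := by
  intro x hx y
  refine (lin1 (Lm a x.1 x.2) (Lm a y.1 y.2)).subset ?_
  intro t ht h
  apply ht
  refine hx.trans ?_
  rw [← Lm_line] at h
  exact h

theorem surj_lineOpen (a : Fin s → Fin r → ℕ) :
    LineOpen (fun x : (Fin s → Fin r → Fin r → ℂ) × (Fin s → Fin q → Fin q → ℂ) =>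
      Surj a x.1 x.2) := by
  have : (fun x : (Fin s → Fin r → Fin r → ℂ) × (Fin s → Fin q → Fin q → ℂ) => Surj a x.1 x.2) =
    (fun x => _) := funext fun x => propext (surj_iff a x.1 x.2)
  rw [this]
  exact rank_lineOpen a _

theorem exists_surj_lineOpen (a : Fin s → Fin d → ℕ) :
    LineOpen (fun x : (Fin s → Fin r → Fin r → ℂ) × (Fin s → Fin q → Fin q → ℂ) =>
      (∃ f' : Fin s → Fin d → Fin d → ℂ, ∃ g' : Fin s → Fin q → Fin q → ℂ, Surj a f' g') →
        ∃ f', Surj a f' x.2) := by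
  intro x hx y
  by_cases hC : ∃ f' : Fin s → Fin d → Fin d → ℂ, ∃ g' : Fin s → Fin q → Fin q → ℂ, Surj a f' g'
  · obtain ⟨f', hf'⟩ := hx hC
    refine (surj_lineOpen a (f', x.2) hf' (0, y.2)).subset ?_
    intro t ht h
    exact ht (fun _ => ⟨_, h⟩)
  · convert Set.finite_empty (α := ℂ)
    ext t
    simp only [Set.mem_ofPred_eq, Set.mem_empty_iff_false, iff_false, not_not]
    exact fun h => absurd h hC

theorem LineOpen.fst {E F : Type*} [AddCommGroup E] [Module ℂ E] [AddCommGroup F] [Module ℂ F]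
    {P : E → Prop} (h : LineOpen P) : LineOpen (fun x : E × F => P x.1) :=
  fun x hx y => h x.1 hx y.1

theorem LineOpen.snd {E F : Type*} [AddCommGroup E] [Module ℂ E] [AddCommGroup F] [Module ℂ F]
    {P : F → Prop} (h : LineOpen P) : LineOpen (fun x : E × F => P x.2) :=
  fun x hx y => h x.2 hx y.2

theorem factor_through {E F G : Type*} [AddCommGroup E] [Module ℂ E] [AddCommGroup F] [Module ℂ F]
    [AddCommGroup G] [Module ℂ G] (φ : E →ₗ[ℂ] F) (ψ : E →ₗ[ℂ] G)
    (h : LinearMap.ker φ ≤ LinearMap.ker ψ) : ∃ z : F →ₗ[ℂ] G, ∀ x, z (φ x) = ψ x := by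
  obtain ⟨σ, hσ⟩ := LinearMap.exists_rightInverse_of_surjective φ.rangeRestrict φ.range_rangeRestrict
  obtain ⟨z, hz⟩ := LinearMap.exists_extend (ψ ∘ₗ σ)
  refine ⟨z, fun x => ?_⟩
  have h1 : z (φ x) = ψ (σ (φ.rangeRestrict x)) := LinearMap.congr_fun hz (φ.rangeRestrict x)
  rw [h1]
  have h2 : φ.rangeRestrict (σ (φ.rangeRestrict x)) = φ.rangeRestrict x := LinearMap.congr_fun hσ _
  have h3 : φ (σ (φ.rangeRestrict x)) = φ x := congrArg Subtype.val h2
  have h4 : x - σ (φ.rangeRestrict x) ∈ LinearMap.ker φ := by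
    rw [LinearMap.mem_ker, map_sub, h3, sub_self]
  have h5 := h h4
  rw [LinearMap.mem_ker, map_sub, sub_eq_zero] at h5
  exact h5.symm

theorem exists_hom_surj {S Q ι : Type*} [AddCommGroup S] [Module ℂ S] [AddCommGroup Q]
    [Module ℂ Q] [FiniteDimensional ℂ S] [FiniteDimensional ℂ Q] [Fintype ι] (x : ι → S)
    (N : ι → Submodule ℂ Q) (h : ∑ p, finrank ℂ (Q ⧸ N p) ≤ finrank ℂ S * finrank ℂ Q)
    (hinj : ∀ u : S →ₗ[ℂ] Q, (∀ p, u (x p) ∈ N p) → u = 0) (α : ι → Q) :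
    ∃ A : S →ₗ[ℂ] Q, ∀ p, α p - A (x p) ∈ N p := by
  classical
  let Ψ : (S →ₗ[ℂ] Q) →ₗ[ℂ] (∀ p, Q ⧸ N p) :=
    LinearMap.pi (fun p => (N p).mkQ ∘ₗ LinearMap.applyₗ (x p))
  have hker : LinearMap.ker Ψ = ⊥ := by
    rw [eq_bot_iff]
    intro u hu
    rw [Submodule.mem_bot]
    exact hinj u fun p => (Submodule.Quotient.mk_eq_zero _).1 (congrFun (LinearMap.mem_ker.1 hu) p)
  have hrange : LinearMap.range Ψ = ⊤ := by
    apply Submodule.eq_top_of_finrank_eq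
    have h1 := LinearMap.finrank_range_add_finrank_ker Ψ
    rw [hker, finrank_bot, Module.finrank_linearMap] at h1
    have h2 := (LinearMap.range Ψ).finrank_le
    rw [Module.finrank_pi_fintype] at h2 ⊢
    omega
  obtain ⟨A, hA⟩ := LinearMap.range_eq_top.1 hrange (fun p => (N p).mkQ (α p))
  refine ⟨A, fun p => ?_⟩
  have := congrFun hA p
  exact (Submodule.Quotient.eq _).1 this.symm

/-- Rank maximality gives the tangency statement. -/
theorem max_rank_tangent (a : Fin s → Fin r → ℕ) (f : Fin s → Fin r → Fin r → ℂ)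
    (g : Fin s → Fin q → Fin q → ℂ)
    (hmax : ∀ g' : Fin s → Fin q → Fin q → ℂ, finrank ℂ (LinearMap.range (Lm a f g')) ≤ finrank ℂ (LinearMap.range (Lm a f g)))
    (φ : (Fin r → ℂ) →ₗ[ℂ] (Fin q → ℂ)) (hφ : ∀ l j, φ (f l j) ∈ Gs (g l) (a l j))
    (z : Fin s → (Fin q → ℂ) →ₗ[ℂ] (Fin q → ℂ)) :
    ∃ A : (Fin r → ℂ) →ₗ[ℂ] (Fin q → ℂ), ∀ l j, z l (φ (f l j)) - A (f l j) ∈ Gs (g l) (a l j) := by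
  choose T hT using fun l j => (mem_Gs_iff _ _ _).1 (hφ l j)
  have h1 : ∀ t : ℂ, finrank ℂ (LinearMap.range (Lm a f g + t • Lm a 0 (fun l i => z l (g l i)))) ≤
      finrank ℂ (LinearMap.range (Lm a f g)) := by
    intro t
    rw [← Lm_line]
    have e : f + t • (0 : Fin s → Fin r → Fin r → ℂ) = f := by rw [smul_zero, add_zero]
    rw [e]
    exact hmax _
  have h2 : Lm a f g (-φ, T) = 0 := by
    funext l j
    have := hT l j
    simp only [Lm, LinearMap.coe_mk, AddHom.coe_mk, this, LinearMap.neg_apply, neg_add_cancel]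
    rfl
  have h := lin2 _ _ h1 _ h2
  rw [mem_range_Lm] at h
  obtain ⟨A, hA⟩ := h
  refine ⟨A, fun l j => ?_⟩
  have h3 := hA l j
  have e : Lm a 0 (fun l i => z l (g l i)) (-φ, T) l j = z l (φ (f l j)) := by
    rw [← hT l j]
    simp only [Lm, LinearMap.coe_mk, AddHom.coe_mk, Pi.zero_apply, map_zero, zero_add, map_sum,
      map_smul]
  rw [e] at h3
  exact h3
end surj

section B2
variable {s d r q : ℕ}

theorem exists_lin {b : Fin r → Fin r → ℂ} (hb : LinearIndependent ℂ b) {Q : Type*} [AddCommGroup Q]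
    [Module ℂ Q] (w : Fin r → Q) : ∃ k : (Fin r → ℂ) →ₗ[ℂ] Q, ∀ j, k (b j) = w j := by
  let B := basisOfLinearIndependentOfCardEqFinrank' b hb (by simp)
  refine ⟨B.constr ℂ w, fun j => ?_⟩
  have : b j = B j := by simp [B]
  rw [this, Basis.constr_basis]

theorem exists_lin_pos {b : Fin r → Fin r → ℂ} (hb : LinearIndependent ℂ b) {Q : Type*}
    [AddCommGroup Q] [Module ℂ Q] {J : Fin d → Fin r} (hJ : Function.Injective J) (w : Fin d → Q) :
    ∃ k : (Fin r → ℂ) →ₗ[ℂ] Q, (∀ i, k (b (J i)) = w i) ∧ ∀ j, j ∉ Set.range J → k (b j) = 0 := by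
  obtain ⟨k, hk⟩ := exists_lin hb (Function.extend J w 0)
  refine ⟨k, fun i => by rw [hk, hJ.extend_apply], fun j hj => ?_⟩
  rw [hk, Function.extend_apply' _ _ _ (fun ⟨i, hi⟩ => hj ⟨i, hi⟩)]
  rfl

theorem B2_final (a : Fin s → Fin r → ℕ) (ha : ∀ l, Monotone (a l))
    (f b : Fin s → Fin r → Fin r → ℂ) (g : Fin s → Fin q → Fin q → ℂ) (hf : Frame f) (hb : Frame b)
    (hfb : ∀ l j, f l j ∈ Fsp (b l) j)
    (hmax : ∀ g' : Fin s → Fin q → Fin q → ℂ,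
      finrank ℂ (LinearMap.range (Lm a f g')) ≤ finrank ℂ (LinearMap.range (Lm a f g)))
    (φ : (Fin r → ℂ) →ₗ[ℂ] (Fin q → ℂ)) (hφ : ∀ l j, φ (f l j) ∈ Gs (g l) (a l j))
    (e : (Fin d → ℂ) →ₗ[ℂ] (Fin r → ℂ)) (he : Function.Injective e)
    (hker : LinearMap.range e = LinearMap.ker φ)
    (J : Fin s → Fin d → Fin r) (hJ : ∀ l, Function.Injective (J l))
    (v : Fin s → Fin d → Fin d → ℂ) (hv : ∀ l k, e (v l k) = b l (J l k))
    (hsurj : Surj (fun l k => a l (J l k)) v g) : Surj a f g := by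
  intro α
  choose αh hαh using fun l => exists_lin (hf l) (α l)
  obtain ⟨A', hA'⟩ := hsurj (fun l k => αh l (b l (J l k)))
  obtain ⟨A, hA⟩ : ∃ A : (Fin r → ℂ) →ₗ[ℂ] (Fin q → ℂ), ∀ x, A (e x) = A' x :=
    factor_through e A' (by rw [LinearMap.ker_eq_bot.2 he]; exact bot_le)
  choose γ hγ1 hγ2 using fun l => exists_lin_pos (hb l) (hJ l)
    (fun k => (αh l - A) (b l (J l k)))
  have hγ3 : ∀ l j, γ l (b l j) ∈ Gs (g l) (a l j) := by
    intro l j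
    by_cases hj : j ∈ Set.range (J l)
    · obtain ⟨k, rfl⟩ := hj
      rw [hγ1, LinearMap.sub_apply, ← hv, hA, hv]
      exact hA' l k
    · rw [hγ2 l j hj]; exact zero_mem _
  have hγ4 : ∀ l j, γ l (f l j) ∈ Gs (g l) (a l j) := by
    intro l j
    have h1 : γ l (f l j) ∈ (Fsp (b l) j).map (γ l) := ⟨_, hfb l j, rfl⟩
    rw [Fsp, Submodule.map_span] at h1
    refine Submodule.span_le.2 ?_ h1
    rintro _ ⟨_, ⟨i, hi, rfl⟩, rfl⟩
    exact Gs_mono _ (ha l hi) (hγ3 l i)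
  have hd : finrank ℂ (LinearMap.ker φ) = d := by
    rw [← hker, LinearMap.finrank_range_of_inj he]; simp
  have hbS : ∀ l k, b l (J l k) ∈ LinearMap.ker φ := fun l k => by
    rw [← hker, ← hv]; exact ⟨_, rfl⟩
  have hz : ∀ l, ∃ z : (Fin q → ℂ) →ₗ[ℂ] (Fin q → ℂ), ∀ x, z (φ x) = (αh l - A - γ l) x := by
    intro l
    apply factor_through
    rw [← pos_span (hb l) hd (hJ l) (hbS l)]
    refine Submodule.span_le.2 ?_
    rintro _ ⟨_, ⟨k, rfl⟩, rfl⟩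
    show (αh l - A - γ l) _ = 0
    rw [LinearMap.sub_apply, hγ1, sub_self]
  choose z hz using hz
  obtain ⟨A2, hA2⟩ := max_rank_tangent a f g hmax φ hφ z
  refine ⟨A + A2, fun l j => ?_⟩
  have h1 := add_mem (hA2 l j) (hγ4 l j)
  rw [hz] at h1
  convert h1 using 1
  simp only [LinearMap.sub_apply, LinearMap.add_apply, hαh]
  abel

theorem B2_step (a : Fin s → Fin r → ℕ) (ha : ∀ l, Monotone (a l))
    (f b : Fin s → Fin r → Fin r → ℂ) (g : Fin s → Fin q → Fin q → ℂ) (hf : Frame f) (hb : Frame b)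
    (hbf : ∀ l j, b l j ∈ Fsp (f l) j)
    (hmax : ∀ (f' : Fin s → Fin r → Fin r → ℂ) (g' : Fin s → Fin q → Fin q → ℂ),
      finrank ℂ (LinearMap.range (Lm a f' g')) ≤ finrank ℂ (LinearMap.range (Lm a f g)))
    (φ : (Fin r → ℂ) →ₗ[ℂ] (Fin q → ℂ)) (hφ : ∀ l j, φ (f l j) ∈ Gs (g l) (a l j))
    (e : (Fin d → ℂ) →ₗ[ℂ] (Fin r → ℂ)) (he : Function.Injective e)
    (hker : LinearMap.range e = LinearMap.ker φ)
    (J : Fin s → Fin d → Fin r) (hJ : ∀ l, Function.Injective (J l))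
    (v : Fin s → Fin d → Fin d → ℂ) (hv : ∀ l k, e (v l k) = b l (J l k))
    (f' : Fin s → Fin d → Fin d → ℂ)
    (hsurj : Surj (fun l k => a l (J l k)) f' g) : ∃ f'', Surj a f'' g := by
  choose k hk1 hk2 using fun l => exists_lin_pos (hb l) (hJ l) (fun i => e (f' l i) - e (v l i))
  have hφe : ∀ x, φ (e x) = 0 := fun x => by
    have : e x ∈ LinearMap.ker φ := by rw [← hker]; exact ⟨x, rfl⟩
    exact this
  have hφk : ∀ l x, φ (k l x) = 0 := by
    intro l
    have h1 : φ ∘ₗ k l = 0 := by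
      let B := basisOfLinearIndependentOfCardEqFinrank' (b l) (hb l) (by simp)
      refine B.ext fun j => ?_
      have : B j = b l j := by simp [B]
      rw [this]
      by_cases hj : j ∈ Set.range (J l)
      · obtain ⟨i, rfl⟩ := hj
        simp [hk1, hφe]
      · simp [hk2 l j hj]
    exact fun x => LinearMap.congr_fun h1 x
  have F1 := (rank_lineOpen a _ (f, g) le_rfl ((fun l j => k l (f l j)), 0))
  have F2 := Frame_lineOpen f hf (fun l j => k l (f l j))
  have F3 := surj_lineOpen (fun l k => a l (J l k)) (f', g) hsurj (v - f', 0)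
  obtain ⟨t, ht⟩ := ((F1.union F2).union (F3.image (fun t => 1 - t))).exists_notMem
  simp only [Set.mem_union, not_or] at ht
  obtain ⟨⟨h1, h2⟩, h3⟩ := ht
  rw [Set.mem_ofPred_eq, not_not] at h1 h2
  have h3' : Surj (fun l k => a l (J l k)) (v + t • (f' - v)) g := by
    by_contra hc
    apply h3
    refine ⟨1 - t, ?_, by ring⟩
    rw [Set.mem_ofPred_eq]
    convert hc using 2
    · simp only [Prod.fst_add, Prod.smul_fst]
      module
    · simp
  set ft : Fin s → Fin r → Fin r → ℂ := f + t • (fun l j => k l (f l j)) with hft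
  let h : Fin s → (Fin r → ℂ) →ₗ[ℂ] (Fin r → ℂ) := fun l => LinearMap.id + t • k l
  have hh : ∀ l x, h l x = x + t • k l x := fun l x => rfl
  have hfth : ∀ l j, ft l j = h l (f l j) := fun l j => rfl
  have hinj : ∀ l, Function.Injective (h l) := by
    intro l
    rw [LinearMap.injective_iff_surjective, ← LinearMap.range_eq_top, eq_top_iff,
      ← (h2 l).span_eq_top_of_card_eq_finrank' (by simp), Submodule.span_le]
    rintro _ ⟨j, rfl⟩
    exact ⟨f l j, rfl⟩
  refine ⟨ft, B2_final a ha ft (fun l j => h l (b l j)) g h2 ?_ ?_ ?_ φ ?_ e he hker J hJ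
    (v + t • (f' - v)) ?_ h3'⟩
  · intro l
    exact (hb l).map' (h l) (LinearMap.ker_eq_bot.2 (hinj l))
  · intro l j
    have h4 : f l j ∈ Fsp (b l) j := by
      rw [Fsp_eq_of_mem (hf l) (hb l) (hbf l)]
      exact mem_Fsp _ le_rfl
    have h5 : h l (f l j) ∈ (Fsp (b l) j).map (h l) := ⟨_, h4, rfl⟩
    rw [Fsp, Submodule.map_span, ← Set.image_comp] at h5
    exact h5
  · intro g'
    refine (hmax ft g').trans ?_
    change _ ≤ finrank ℂ (LinearMap.range (Lm a ft (g + t • 0))) at h1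
    rw [smul_zero, add_zero] at h1
    exact h1
  · intro l j
    rw [hfth, hh, map_add, map_smul, hφk, smul_zero, add_zero]
    exact hφ l j
  · intro l i
    rw [hh, hk1, ← hv]
    simp

theorem SS_restrict {a : Fin s → Fin r → ℕ} (ha : ∀ l, Monotone (a l))
    {f b : Fin s → Fin r → Fin r → ℂ} (hf : SS q a f) (hb : Frame b)
    (hbf : ∀ l j, b l j ∈ Fsp (f l) j)
    (e : (Fin d → ℂ) →ₗ[ℂ] (Fin r → ℂ)) (he : Function.Injective e)
    (J : Fin s → Fin d → Fin r) (hJ : ∀ l, Function.Injective (J l))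
    (v : Fin s → Fin d → Fin d → ℂ) (hv : ∀ l k, e (v l k) = b l (J l k)) :
    SS q (fun l k => a l (J l k)) v := by
  refine ⟨fun l => ?_, fun S => ?_⟩
  · have : LinearIndependent ℂ (e ∘ v l) := by
      have e1 : e ∘ v l = b l ∘ J l := funext (hv l)
      rw [e1]
      exact (hb l).comp _ (hJ l)
    exact LinearIndependent.of_comp e this
  · refine (hf.2 (S.map e)).trans ?_
    unfold chi
    rw [finrank_map_inj he]
    refine sub_le_sub_left (Finset.sum_le_sum fun l _ => Finset.sum_le_sum fun c _ => ?_) _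
    rw [← finrank_map_inj he]
    refine Nat.cast_le.2 (Submodule.finrank_mono ?_)
    refine (Submodule.map_inf_le e).trans (inf_le_inf_left _ ?_)
    rw [Wsp, Wsp, ← span_lower_eq (hf.1 l) (hb l) (hbf l) (lower_a (ha l) c),
      Submodule.map_span, Submodule.span_le]
    rintro _ ⟨_, ⟨i, hi, rfl⟩, rfl⟩
    rw [hv]
    exact Submodule.subset_span ⟨_, hi, rfl⟩

theorem exists_frame (s q : ℕ) : ∃ g : Fin s → Fin q → Fin q → ℂ, Frame g :=
  ⟨fun _ i => Pi.single i 1, fun _ => by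
    have := (Pi.basisFun ℂ (Fin q)).linearIndependent
    have e : (fun i => Pi.single i 1 : Fin q → Fin q → ℂ) = Pi.basisFun ℂ (Fin q) := by
      funext i; simp
    rw [e]
    exact this⟩

theorem exists_surj (r : ℕ) : ∀ (a : Fin s → Fin r → ℕ), (∀ l, Monotone (a l)) →
    (∀ l j, a l j ≤ q) → (∃ f : Fin s → Fin r → Fin r → ℂ, SS q a f) →
    ∃ (f : Fin s → Fin r → Fin r → ℂ) (g : Fin s → Fin q → Fin q → ℂ), Surj a f g := by
  induction r using Nat.strong_induction_on with
  | _ r ih =>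
  intro a ha haq hSS
  obtain ⟨m, ⟨x0, hx0⟩, hm⟩ : ∃ m : ℕ, (∃ x : (Fin s → Fin r → Fin r → ℂ) × (Fin s → Fin q → Fin q → ℂ),
      m ≤ finrank ℂ (LinearMap.range (Lm a x.1 x.2))) ∧
      ∀ x : (Fin s → Fin r → Fin r → ℂ) × (Fin s → Fin q → Fin q → ℂ),
        finrank ℂ (LinearMap.range (Lm a x.1 x.2)) ≤ m := by
    have hfin : (Set.range (fun x : (Fin s → Fin r → Fin r → ℂ) × (Fin s → Fin q → Fin q → ℂ) =>
        finrank ℂ (LinearMap.range (Lm a x.1 x.2)))).Finite := by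
      refine (Set.finite_Iic (finrank ℂ (Fin s → Fin r → Fin q → ℂ))).subset ?_
      rintro _ ⟨x, rfl⟩
      exact Submodule.finrank_le _
    obtain ⟨_, ⟨x, rfl⟩, hx2⟩ := Set.exists_max_image _ id hfin (Set.range_nonempty _)
    exact ⟨_, ⟨x, le_rfl⟩, fun y => hx2 _ ⟨y, rfl⟩⟩
  have hP3 := LineOpen.exists_forall (ι := Σ d : Fin r, Fin s → Fin d → Fin r)
    (fun i => exists_surj_lineOpen (r := r) (q := q) (fun l k => a l (i.2 l k)))
    (fun i => by
      by_cases hC : ∃ f' : Fin s → Fin i.1 → Fin i.1 → ℂ, ∃ g' : Fin s → Fin q → Fin q → ℂ,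
          Surj (fun l k => a l (i.2 l k)) f' g'
      · obtain ⟨f', g', h⟩ := hC
        exact ⟨(0, g'), fun _ => ⟨f', h⟩⟩
      · exact ⟨0, fun h => absurd h hC⟩)
  obtain ⟨⟨f, g⟩, ⟨⟨hf, hg⟩, hrk⟩, h3⟩ := ((((SS_lineOpen ha haq).fst.and Frame_lineOpen.snd).and
    (rank_lineOpen a m)).exists_and
    (LineOpen.forall_fin (ι := Σ d : Fin r, Fin s → Fin d → Fin r)
    (fun i => exists_surj_lineOpen (r := r) (q := q) (fun l k => a l (i.2 l k))))
    (LineOpen.exists_and ((SS_lineOpen ha haq).fst.and Frame_lineOpen.snd) (rank_lineOpen a m)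
      (by
        obtain ⟨f, hf⟩ := hSS
        obtain ⟨g, hg⟩ := exists_frame s q
        exact ⟨(f, g), hf, hg⟩) ⟨x0, hx0⟩) hP3)
  simp only at hf hg hrk h3
  have hmax : ∀ (f' : Fin s → Fin r → Fin r → ℂ) (g' : Fin s → Fin q → Fin q → ℂ),
      finrank ℂ (LinearMap.range (Lm a f' g')) ≤ finrank ℂ (LinearMap.range (Lm a f g)) :=
    fun f' g' => (hm (f', g')).trans hrk
  by_cases hφ : ∀ φ : (Fin r → ℂ) →ₗ[ℂ] (Fin q → ℂ),
      (∀ p : Fin s × Fin r, φ (f p.1 p.2) ∈ Gs (g p.1) (a p.1 p.2)) → φ = 0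
  · refine ⟨f, g, fun α => ?_⟩
    obtain ⟨A, hA⟩ := exists_hom_surj (fun p : Fin s × Fin r => f p.1 p.2)
      (fun p => Gs (g p.1) (a p.1 p.2)) (by
        have h1 := hf.2 ⊤
        have h2 := chi_eq ha haq hf.1 hf.1 (fun l j => mem_Fsp _ le_rfl) (d := r) (by simp)
          (J := fun l => id) (fun l => strictMono_id) (S := ⊤) (by simp)
        rw [h2] at h1
        have h3 : ∀ p : Fin s × Fin r, (finrank ℂ ((Fin q → ℂ) ⧸ Gs (g p.1) (a p.1 p.2)) : ℤ) =
            q - a p.1 p.2 := by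
          intro p
          have h4 := (Gs (g p.1) (a p.1 p.2)).finrank_quotient_add_finrank
          rw [Gs_finrank (hg p.1) (haq _ _), Module.finrank_fin_fun] at h4
          omega
        zify
        simp only [h3, Module.finrank_fin_fun]
        rw [Fintype.sum_prod_type]
        unfold ed at h1
        simp only [id] at h1
        linarith) hφ (fun p => α p.1 p.2)
    exact ⟨A, fun l j => hA (l, j)⟩
  · push Not at hφ
    obtain ⟨φ, hφ, hφ0⟩ := hφ
    obtain ⟨d, hd⟩ : ∃ d, finrank ℂ (LinearMap.ker φ) = d := ⟨_, rfl⟩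
    have hdr : d < r := by
      rw [← hd]
      have h1 : LinearMap.ker φ < ⊤ := lt_top_iff_ne_top.2 (fun h => hφ0 (LinearMap.ker_eq_top.1 h))
      have := Submodule.finrank_lt_finrank_of_lt h1
      rwa [finrank_top, Module.finrank_fin_fun] at this
    choose b hb hbf J hJ hbS using fun l => pos_lemma (hf.1 l) (LinearMap.ker φ) hd
    let e0 : LinearMap.ker φ ≃ₗ[ℂ] (Fin d → ℂ) := LinearEquiv.ofFinrankEq _ _ (by rw [hd]; simp)
    let e : (Fin d → ℂ) →ₗ[ℂ] (Fin r → ℂ) := (LinearMap.ker φ).subtype ∘ₗ e0.symm.toLinearMap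
    have he : Function.Injective e := (LinearMap.ker φ).injective_subtype.comp e0.symm.injective
    have hker : LinearMap.range e = LinearMap.ker φ := by
      rw [LinearMap.range_comp, LinearEquiv.range, Submodule.map_top, Submodule.range_subtype]
    let v : Fin s → Fin d → Fin d → ℂ := fun l k => e0 ⟨b l (J l k), hbS l k⟩
    have hv : ∀ l k, e (v l k) = b l (J l k) := fun l k => by simp [e, v]
    have hSSv := SS_restrict ha hf hb hbf e he J (fun l => (hJ l).injective) v hv
    have hC := ih d hdr (fun l k => a l (J l k)) (fun l => (ha l).comp (hJ l).monotone)
      (fun l k => haq _ _) ⟨v, hSSv⟩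
    obtain ⟨f', hf'⟩ := h3 ⟨⟨d, hdr⟩, J⟩ hC
    obtain ⟨f'', h''⟩ := B2_step a ha f b g hf.1 hb hbf hmax φ (fun l j => hφ (l, j)) e he hker J
      (fun l => (hJ l).injective) v hv f' hf'
    exact ⟨f'', g, h''⟩

theorem exists_surj_frame (r : ℕ) (a : Fin s → Fin r → ℕ) (ha : ∀ l, Monotone (a l))
    (haq : ∀ l j, a l j ≤ q) (h : ∃ f : Fin s → Fin r → Fin r → ℂ, SS q a f) :
    ∃ (f : Fin s → Fin r → Fin r → ℂ) (g : Fin s → Fin q → Fin q → ℂ), Frame f ∧ Frame g ∧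
      Surj a f g := by
  obtain ⟨f, g, hS⟩ := exists_surj r a ha haq h
  obtain ⟨f1, hf1⟩ := exists_frame s r
  obtain ⟨g1, hg1⟩ := exists_frame s q
  obtain ⟨x, ⟨h1, h2⟩, h3⟩ := (Frame_lineOpen.fst.and Frame_lineOpen.snd).exists_and
    (surj_lineOpen a) ⟨(f1, g1), hf1, hg1⟩ ⟨(f, g), hS⟩
  exact ⟨x.1, x.2, h1, h2, h3⟩
end B2

section horn
variable {s d r q : ℕ}

theorem ed_nonneg_of_Surj {a : Fin s → Fin r → ℕ} (ha : ∀ l, Monotone (a l)) (haq : ∀ l j, a l j ≤ q)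
    {f : Fin s → Fin r → Fin r → ℂ} {g : Fin s → Fin q → Fin q → ℂ} (hf : Frame f) (hg : Frame g)
    (hS : Surj a f g) (J : Fin s → Fin d → Fin r) (hJ : Zp J f) :
    0 ≤ ed q (fun l k => a l (J l k)) := by
  obtain ⟨S, hd, hZ⟩ := hJ
  choose b hb hbf P hP hbS using fun l => pos_lemma (hf l) S hd
  have hle : ∀ l k, P l k ≤ J l k := fun l k =>
    pos_le (hf l) (hb l) (hbf l) hd (hP l) (hbS l) k _ (hZ l k)
  let Ψ : (S →ₗ[ℂ] (Fin q → ℂ)) →ₗ[ℂ]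
      (∀ l : Fin s, ∀ k : Fin d, (Fin q → ℂ) ⧸ Gs (g l) (a l (P l k))) :=
    LinearMap.pi fun l => LinearMap.pi fun k =>
      (Gs (g l) (a l (P l k))).mkQ.comp (LinearMap.applyₗ (⟨b l (P l k), hbS l k⟩ : S))
  have hΨ : Function.Surjective Ψ := by
    intro y
    choose α' hα' using fun l k => Submodule.mkQ_surjective _ (y l k)
    choose αh hαh _ using fun l => exists_lin_pos (hb l) (hP l).injective (α' l)
    obtain ⟨A, hA⟩ := hS (fun l j => αh l (f l j))
    refine ⟨A.comp S.subtype, ?_⟩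
    funext l k
    rw [← hα' l k]
    show (Gs (g l) (a l (P l k))).mkQ (A (b l (P l k))) = _
    symm
    rw [← sub_eq_zero, ← map_sub, Submodule.mkQ_apply, Submodule.Quotient.mk_eq_zero, ← hαh]
    have h1 : (αh l - A) (b l (P l k)) ∈ (Fsp (f l) (P l k)).map (αh l - A) :=
      ⟨_, hbf l (P l k), rfl⟩
    rw [Fsp, Submodule.map_span] at h1
    rw [← LinearMap.sub_apply]
    refine Submodule.span_le.2 ?_ h1
    rintro _ ⟨_, ⟨i, hi, rfl⟩, rfl⟩
    exact Gs_mono _ (ha l hi) (hA l i)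
  have h1 := LinearMap.finrank_le_finrank_of_surjective hΨ
  have h2 : finrank ℂ (∀ l : Fin s, ∀ k : Fin d, (Fin q → ℂ) ⧸ Gs (g l) (a l (P l k))) =
      ∑ l : Fin s, ∑ k : Fin d, (q - a l (P l k)) := by
    rw [finrank_pi_fintype]
    refine Finset.sum_congr rfl fun l _ => ?_
    rw [finrank_pi_fintype]
    refine Finset.sum_congr rfl fun k _ => ?_
    have := Submodule.finrank_quotient_add_finrank (Gs (g l) (a l (P l k)))
    rw [Gs_finrank (hg l) (haq l _), finrank_fin_fun] at this
    omega
  rw [h2, finrank_linearMap, hd, finrank_fin_fun] at h1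
  have h3 : ∑ l : Fin s, ∑ k : Fin d, ((q : ℤ) - a l (J l k)) ≤
      ((∑ l : Fin s, ∑ k : Fin d, (q - a l (P l k)) : ℕ) : ℤ) := by
    push_cast
    refine Finset.sum_le_sum fun l _ => Finset.sum_le_sum fun k _ => ?_
    have e1 := ha l (hle l k)
    have e2 := haq l (P l k)
    have e3 := haq l (J l k)
    omega
  have h4 : ((∑ l : Fin s, ∑ k : Fin d, (q - a l (P l k)) : ℕ) : ℤ) ≤ ((d * q : ℕ) : ℤ) := by
    exact_mod_cast h1
  push_cast at h4
  rw [ed]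
  push_cast at h3
  linarith

end horn

section chartC
variable {s r q n : ℕ}

theorem exists_compl (I : Fin r → Fin n) (hI : StrictMono I) (hn : r + q = n) :
    ∃ C : Fin q → Fin n, Function.Injective C ∧ (∀ i, C i ∉ Set.range I) ∧
      (∀ x, x ∉ Set.range I → ∃ i, C i = x) ∧ ∀ (j : Fin r) (i : Fin q), (i : ℕ) < (I j : ℕ) - j → C i < I j := by
  classical
  let T : Finset (Fin n) := (Finset.univ.image I)ᶜ
  have hT : T.card = q := by
    rw [Finset.card_compl, Finset.card_image_of_injective _ hI.injective]
    simp; omega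
  let C := T.orderEmbOfFin hT
  have hC : ∀ x, x ∈ Set.range C ↔ x ∉ Set.range I := by
    intro x
    rw [Finset.range_orderEmbOfFin]
    simp [T]
  refine ⟨C, C.injective, fun i => (hC _).1 ⟨i, rfl⟩, fun x hx => (hC x).2 hx, ?_⟩
  intro j i hi
  by_contra hcon
  rw [not_lt] at hcon
  have hsub : Finset.Iio (I j) ⊆ (Finset.Iio j).image I ∪ (Finset.Iio i).image C := by
    intro x hx
    rw [Finset.mem_Iio] at hx
    rw [Finset.mem_union, Finset.mem_image, Finset.mem_image]
    by_cases hxI : x ∈ Set.range I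
    · obtain ⟨j', rfl⟩ := hxI
      exact Or.inl ⟨j', Finset.mem_Iio.2 (hI.lt_iff_lt.1 hx), rfl⟩
    · obtain ⟨i', rfl⟩ := (hC x).2 hxI
      exact Or.inr ⟨i', Finset.mem_Iio.2 (C.lt_iff_lt.1 (hx.trans_le hcon)), rfl⟩
  have h1 := (Finset.card_le_card hsub).trans (Finset.card_union_le _ _)
  have h2 := (Finset.card_image_le (s := Finset.Iio j) (f := I))
  have h3 := (Finset.card_image_le (s := Finset.Iio i) (f := C))
  rw [Fin.card_Iio] at h1 h2 h3
  omega

abbrev PX (s r q n : ℕ) := ((Fin r → ℂ) →L[ℂ] (Fin q → ℂ)) ×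
  (Fin s → Fin n → (Fin r → ℂ) × (Fin q → ℂ)) × (Fin s → Fin n → Fin n → ℂ)

open Classical in
noncomputable def bb (I : Fin s → Fin r → Fin n) (e : ((Fin r → ℂ) × (Fin q → ℂ)) ≃L[ℂ] (Fin n → ℂ))
    (x : PX s r q n) (l : Fin s) (i : Fin n) : Fin n → ℂ :=
  if i ∈ Set.range (I l) then e ((x.2.1 l i).1, x.1 (x.2.1 l i).1) else e (x.2.1 l i)

noncomputable def PhiC (I : Fin s → Fin r → Fin n)
    (e : ((Fin r → ℂ) × (Fin q → ℂ)) ≃L[ℂ] (Fin n → ℂ))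
    (x : PX s r q n) (l : Fin s) (j : Fin n) : Fin n → ℂ :=
  bb I e x l j + ∑ i : Fin n, (if i < j then x.2.2 l j i else 0) • bb I e x l i

theorem contDiff_bb (I : Fin s → Fin r → Fin n)
    (e : ((Fin r → ℂ) × (Fin q → ℂ)) ≃L[ℂ] (Fin n → ℂ)) (l : Fin s) (i : Fin n) :
    ContDiff ℂ 1 (fun x : PX s r q n => bb I e x l i) := by
  unfold bb
  by_cases h : i ∈ Set.range (I l)
  · simp only [if_pos h]
    refine e.contDiff.comp ?_
    have h1 : ContDiff ℂ 1 (fun x : PX s r q n => (x.2.1 l i).1) := by fun_prop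
    exact h1.prodMk (contDiff_fst.clm_apply h1)
  · simp only [if_neg h]
    refine e.contDiff.comp ?_
    fun_prop

theorem contDiff_PhiC (I : Fin s → Fin r → Fin n)
    (e : ((Fin r → ℂ) × (Fin q → ℂ)) ≃L[ℂ] (Fin n → ℂ)) :
    ContDiff ℂ 1 (PhiC (q := q) I e) := by
  refine contDiff_pi.2 fun l => contDiff_pi.2 fun j => ?_
  unfold PhiC
  refine (contDiff_bb I e l j).add (ContDiff.sum fun i _ => ?_)
  have h1 : ContDiff ℂ 1 (fun x : PX s r q n => (if i < j then x.2.2 l j i else 0 : ℂ)) := by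
    split_ifs
    · fun_prop
    · fun_prop
  exact h1.smul (contDiff_bb I e l i)

theorem Zp_PhiC (I : Fin s → Fin r → Fin n) (hI : ∀ l, StrictMono (I l))
    (e : ((Fin r → ℂ) × (Fin q → ℂ)) ≃L[ℂ] (Fin n → ℂ)) (x : PX s r q n)
    (hF : Frame (PhiC I e x)) : Zp I (PhiC I e x) := by
  classical
  have hmem : ∀ l, ∀ j : Fin n, bb I e x l j ∈ Fsp (PhiC I e x l) j := by
    intro l j
    induction j using WellFoundedLT.induction with
    | _ j ih =>
      have h1 : bb I e x l j = PhiC I e x l j -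
          ∑ i : Fin n, (if i < j then x.2.2 l j i else 0) • bb I e x l i := by
        rw [PhiC]; abel
      rw [h1]
      refine sub_mem (mem_Fsp _ le_rfl) (Submodule.sum_mem _ fun i _ => ?_)
      split_ifs with hij
      · exact Submodule.smul_mem _ _ (Fsp_mono _ hij.le (ih i hij))
      · rw [zero_smul]; exact zero_mem _
  have hb : ∀ l, LinearIndependent ℂ (bb I e x l) := by
    intro l
    refine linearIndependent_of_top_le_span_of_card_eq_finrank ?_ (by simp)
    rw [← (hF l).span_eq_top_of_card_eq_finrank' (by simp)]
    refine Submodule.span_le.2 ?_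
    rintro _ ⟨j, rfl⟩
    have h2 : PhiC I e x l j = bb I e x l j +
          ∑ i : Fin n, (if i < j then x.2.2 l j i else 0) • bb I e x l i := rfl
    rw [h2]
    refine add_mem (Submodule.subset_span ⟨j, rfl⟩) (Submodule.sum_mem _ fun i _ => ?_)
    exact Submodule.smul_mem _ _ (Submodule.subset_span ⟨i, rfl⟩)
  let G : (Fin r → ℂ) →ₗ[ℂ] (Fin n → ℂ) :=
    e.toLinearEquiv.toLinearMap.comp (LinearMap.id.prod x.1.toLinearMap)
  have hG : ∀ v, G v = e (v, x.1 v) := fun v => rfl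
  have hGi : Function.Injective G := by
    intro v w h
    rw [hG, hG] at h
    exact (Prod.ext_iff.1 (e.injective h)).1
  refine ⟨LinearMap.range G, by rw [LinearMap.finrank_range_of_inj hGi]; simp, fun l k => ?_⟩
  have h3 := finrank_span_image ((hb l).comp _ (hI l).injective) (Finset.Iic k)
  rw [Fin.card_Iic] at h3
  rw [← h3]
  refine Submodule.finrank_mono (le_inf ?_ ?_)
  · refine Submodule.span_le.2 ?_
    rintro _ ⟨j, hj, rfl⟩
    refine ⟨(x.2.1 l (I l j)).1, ?_⟩
    rw [hG]
    simp [bb]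
  · refine Submodule.span_le.2 ?_
    rintro _ ⟨j, hj, rfl⟩
    have : j ≤ k := by simpa using hj
    exact Fsp_mono _ ((hI l).monotone this) (hmem l (I l j))

end chartC

section chartC2
variable {s r q n : ℕ}

theorem frame_isOpen : IsOpen {f : Fin s → Fin n → Fin n → ℂ | Frame f} := by
  have : {f : Fin s → Fin n → Fin n → ℂ | Frame f} = ⋂ l, {f | (Matrix.of (f l)).det ≠ 0} := by
    ext f
    simp only [Set.mem_ofPred_eq, Set.mem_iInter, Frame]
    refine forall_congr' (fun l => ?_)
    have := Matrix.linearIndependent_rows_iff_isUnit (A := Matrix.of (f l))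
    rw [Matrix.isUnit_iff_isUnit_det, isUnit_iff_ne_zero] at this
    exact this
  rw [this]
  refine isOpen_iInter_of_finite (fun l => ?_)
  refine isOpen_ne_fun ?_ continuous_const
  have h1 : Continuous (fun f : Fin s → Fin n → Fin n → ℂ => (Matrix.of (f l) : Matrix (Fin n) (Fin n) ℂ)) :=
    continuous_apply l
  exact h1.matrix_det

open Classical in
theorem deriv_bb (I : Fin s → Fin r → Fin n)
    (e : ((Fin r → ℂ) × (Fin q → ℂ)) ≃L[ℂ] (Fin n → ℂ))
    (c0 : Fin s → Fin n → (Fin r → ℂ) × (Fin q → ℂ)) (v : PX s r q n) (l : Fin s) (i : Fin n) :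
    HasDerivAt (fun t : ℂ => bb I e (((0, c0, 0) : PX s r q n) + t • v) l i)
      (if i ∈ Set.range (I l) then e ((v.2.1 l i).1, v.1 (c0 l i).1) else e (v.2.1 l i)) 0 := by
  have hid : HasDerivAt (fun t : ℂ => t) 1 0 := hasDerivAt_id 0
  have hc : ∀ (y z : (Fin r → ℂ) × (Fin q → ℂ)), HasDerivAt (fun t : ℂ => y + t • z) z 0 := by
    intro y z
    have := (hid.smul_const z).const_add y
    simpa using this
  unfold bb
  by_cases h : i ∈ Set.range (I l)
  · simp only [if_pos h]
    refine e.hasFDerivAt.comp_hasDerivAt (0 : ℂ) ?_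
    have h1 : HasDerivAt (fun t : ℂ => (c0 l i).1 + t • (v.2.1 l i).1) (v.2.1 l i).1 0 := by
      have := (hid.smul_const (v.2.1 l i).1).const_add (c0 l i).1
      simpa using this
    have h2 : HasDerivAt (fun t : ℂ => t • v.1 ((c0 l i).1 + t • (v.2.1 l i).1))
        (v.1 (c0 l i).1) 0 := by
      have := hid.fun_smul (v.1.hasFDerivAt.comp_hasDerivAt (0 : ℂ) h1)
      refine this.congr_deriv ?_
      simp
    have := h1.prodMk h2
    simpa using this
  · simp only [if_neg h]
    refine e.hasFDerivAt.comp_hasDerivAt (0 : ℂ) ?_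
    exact hc (c0 l i) (v.2.1 l i)

open Classical in
theorem deriv_PhiC (I : Fin s → Fin r → Fin n)
    (e : ((Fin r → ℂ) × (Fin q → ℂ)) ≃L[ℂ] (Fin n → ℂ))
    (c0 : Fin s → Fin n → (Fin r → ℂ) × (Fin q → ℂ)) (v : PX s r q n) :
    fderiv ℂ (PhiC I e) ((0, c0, 0) : PX s r q n) v = fun l j =>
      (if j ∈ Set.range (I l) then e ((v.2.1 l j).1, v.1 (c0 l j).1) else e (v.2.1 l j)) +
      ∑ i : Fin n, (if i < j then v.2.2 l j i else 0) • bb I e ((0, c0, 0) : PX s r q n) l i := by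
  have hz : ((0, c0, 0) : PX s r q n) + (0 : ℂ) • v = (0, c0, 0) := by
    have h0 : (0 : ℂ) • v = 0 := zero_smul ℂ v
    exact (congrArg _ h0).trans (add_zero _)
  have hd : HasFDerivAt (PhiC I e) (fderiv ℂ (PhiC I e) ((0, c0, 0) : PX s r q n))
      (((0, c0, 0) : PX s r q n) + (0 : ℂ) • v) := by
    rw [hz]
    exact ((contDiff_PhiC I e).differentiable (by norm_num) _).hasFDerivAt
  have hid : HasDerivAt (fun t : ℂ => t) 1 0 := hasDerivAt_id 0
  have hl : HasDerivAt (fun t : ℂ => ((0, c0, 0) : PX s r q n) + t • v) v 0 := by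
    have := (hid.smul_const v).const_add ((0, c0, 0) : PX s r q n)
    simpa using this
  have h1 := hd.comp_hasDerivAt (0 : ℂ) hl
  refine h1.unique ?_
  refine hasDerivAt_pi.2 fun l => hasDerivAt_pi.2 fun j => ?_
  refine (deriv_bb I e c0 v l j).add (HasDerivAt.fun_sum fun i _ => ?_)
  have h2 : HasDerivAt (fun t : ℂ =>
      (if i < j then (((0, c0, 0) : PX s r q n) + t • v).2.2 l j i else 0 : ℂ))
      (if i < j then v.2.2 l j i else 0) 0 := by
    split_ifs
    · have := hid.mul_const (v.2.2 l j i)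
      simpa using this
    · exact hasDerivAt_const _ _
  have h3 := h2.fun_smul (deriv_bb I e c0 v l i)
  rw [hz] at h3
  refine h3.congr_deriv ?_
  simp

end chartC2

section final
variable {s r q n : ℕ}

theorem generic_of_Surj (I : Fin s → Fin r → Fin n) (hI : ∀ l, StrictMono (I l)) (hn : r + q = n)
    {f : Fin s → Fin r → Fin r → ℂ} {g : Fin s → Fin q → Fin q → ℂ} (hf : Frame f) (hg : Frame g)
    (hS : Surj (fun l j => (I l j : ℕ) - (j : ℕ)) f g) :
    ∀ m : Fin s → Fin n → Fin n → ℂ, Frame m → Zp I m := by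
  classical
  choose C hC1 hC2 hC3 hC4 using fun l => exists_compl (q := q) (I l) (hI l) hn
  let e : ((Fin r → ℂ) × (Fin q → ℂ)) ≃L[ℂ] (Fin n → ℂ) :=
    (LinearEquiv.ofFinrankEq ((Fin r → ℂ) × (Fin q → ℂ)) (Fin n → ℂ)
      (by simp [hn])).toContinuousLinearEquiv
  have hbij : ∀ l, Function.Bijective (Sum.elim (I l) (C l)) := by
    intro l
    constructor
    · refine Function.Injective.sumElim (hI l).injective (hC1 l) ?_
      intro j i h
      exact hC2 l i ⟨j, h⟩
    · intro x
      by_cases hx : x ∈ Set.range (I l)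
      · obtain ⟨j, rfl⟩ := hx
        exact ⟨Sum.inl j, rfl⟩
      · obtain ⟨i, rfl⟩ := hC3 l x hx
        exact ⟨Sum.inr i, rfl⟩
  let σ : ∀ l, Fin r ⊕ Fin q ≃ Fin n := fun l => Equiv.ofBijective _ (hbij l)
  let w : ∀ l : Fin s, Fin r ⊕ Fin q → (Fin r → ℂ) × (Fin q → ℂ) := fun l =>
    Sum.elim (LinearMap.inl ℂ (Fin r → ℂ) (Fin q → ℂ) ∘ f l)
      (LinearMap.inr ℂ (Fin r → ℂ) (Fin q → ℂ) ∘ g l)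
  let c0 : Fin s → Fin n → (Fin r → ℂ) × (Fin q → ℂ) := fun l i => w l ((σ l).symm i)
  have hcI : ∀ l j, c0 l (I l j) = (f l j, 0) := by
    intro l j
    have : (σ l).symm (I l j) = Sum.inl j := by
      rw [Equiv.symm_apply_eq]; rfl
    simp only [c0, this]
    rfl
  have hcC : ∀ l i, c0 l (C l i) = (0, g l i) := by
    intro l i
    have : (σ l).symm (C l i) = Sum.inr i := by
      rw [Equiv.symm_apply_eq]; rfl
    simp only [c0, this]
    rfl
  have hb0 : ∀ l i, bb I e ((0, c0, 0) : PX s r q n) l i = e (c0 l i) := by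
    intro l i
    unfold bb
    split_ifs with h
    · obtain ⟨j, rfl⟩ := h
      simp only [hcI]
      rfl
    · rfl
  have hP0 : PhiC I e ((0, c0, 0) : PX s r q n) = fun l i => e (c0 l i) := by
    funext l j
    rw [PhiC, hb0]
    rw [Finset.sum_eq_zero, add_zero]
    intro i _
    simp
  have hF0 : Frame (PhiC I e ((0, c0, 0) : PX s r q n)) := by
    rw [hP0]
    intro l
    have h1 : LinearIndependent ℂ (w l) := linearIndependent_inl_union_inr' (hf l) (hg l)
    have h2 : LinearIndependent ℂ (c0 l) := h1.comp _ (σ l).symm.injective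
    exact h2.map' e.toLinearEquiv.toLinearMap e.toLinearEquiv.ker
  have hsurj : (fderiv ℂ (PhiC I e) ((0, c0, 0) : PX s r q n)).range = ⊤ := by
    refine LinearMap.range_eq_top.2 fun y => ?_
    obtain ⟨A, hA⟩ := hS (fun l j => (e.symm (y l (I l j))).2)
    choose T hT using fun l j => (mem_Gs_iff _ _ _).1 (hA l j)
    let β : Fin s → Fin n → Fin n → ℂ := fun l j i =>
      Function.extend (I l) (fun j' => Function.extend (C l)
        (fun i' => if (i' : ℕ) < (I l j' : ℕ) - j' then T l j' i' else 0) 0 i) 0 j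
    refine ⟨(A.toContinuousLinearMap, fun l j => e.symm (y l j), β), ?_⟩
    refine (deriv_PhiC I e c0 _).trans ?_
    funext l j
    by_cases hj : j ∈ Set.range (I l)
    · rw [if_pos hj]
      obtain ⟨j, rfl⟩ := hj
      have h1 : ∑ i : Fin n, (if i < I l j then β l (I l j) i else 0) •
          bb I e ((0, c0, 0) : PX s r q n) l i =
          e (0, ∑ i : Fin q, (if (i : ℕ) < (I l j : ℕ) - j then T l j i else 0) • g l i) := by
        have hβ : ∀ i, β l (I l j) i = Function.extend (C l)
            (fun i' => if (i' : ℕ) < (I l j : ℕ) - j then T l j i' else 0) 0 i := by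
          intro i
          simp only [β]
          rw [(hI l).injective.extend_apply]
        rw [← (σ l).sum_comp, Fintype.sum_sum_type]
        have e1 : ∀ j', σ l (Sum.inl j') = I l j' := fun _ => rfl
        have e2 : ∀ i', σ l (Sum.inr i') = C l i' := fun _ => rfl
        have z1 : ∀ j', β l (I l j) (I l j') = 0 := by
          intro j'
          rw [hβ, Function.extend_apply' _ _ _ (fun ⟨i, hi⟩ => hC2 l i ⟨j', hi.symm⟩)]
          rfl
        have z2 : ∀ i', (if C l i' < I l j then β l (I l j) (C l i') else 0) =
            if (i' : ℕ) < (I l j : ℕ) - j then T l j i' else 0 := by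
          intro i'
          rw [hβ, (hC1 l).extend_apply]
          by_cases h : (i' : ℕ) < (I l j : ℕ) - j
          · rw [if_pos (hC4 l j i' h)]
          · rw [if_neg h, ite_self]
        simp only [e1, e2, z1, z2, ite_self, zero_smul, Finset.sum_const_zero, zero_add, hb0, hcC]
        have h0 : ((0, ∑ i : Fin q, (if (i : ℕ) < (I l j : ℕ) - j then T l j i else 0) • g l i) :
            (Fin r → ℂ) × (Fin q → ℂ)) = ∑ i : Fin q,
              (if (i : ℕ) < (I l j : ℕ) - j then T l j i else 0) • ((0 : Fin r → ℂ), g l i) := by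
          refine Prod.ext ?_ ?_
          · simp only [Prod.fst_sum, Prod.smul_fst, smul_zero, Finset.sum_const_zero]
          · simp only [Prod.snd_sum, Prod.smul_snd]
        rw [h0, map_sum]
        simp only [map_smul]
      refine (congrArg _ h1).trans ?_
      rw [hT, ← map_add]
      simp only [hcI]
      rw [← e.apply_symm_apply (y l (I l j))]
      congr 1
      ext <;> simp
    · rw [if_neg hj]
      simp only [e.apply_symm_apply]
      rw [Finset.sum_eq_zero, add_zero]
      intro i _
      have : β l j i = 0 := by
        simp only [β]
        rw [Function.extend_apply' _ _ _ (fun ⟨i, hi⟩ => hj ⟨i, hi⟩)]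
        rfl
      simp only [this, ite_self, zero_smul]
  have hstrict : HasStrictFDerivAt (PhiC I e) (fderiv ℂ (PhiC I e) ((0, c0, 0) : PX s r q n))
      ((0, c0, 0) : PX s r q n) :=
    (contDiff_PhiC I e).contDiffAt.hasStrictFDerivAt (by norm_num)
  have hmap := hstrict.map_nhds_eq_of_surj hsurj
  refine generic_of_open I _ hF0 ?_
  have hF : ∀ᶠ m in nhds (PhiC I e ((0, c0, 0) : PX s r q n)), Frame m :=
    frame_isOpen.mem_nhds hF0
  rw [← hmap] at hF ⊢
  rw [Filter.eventually_map] at hF ⊢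
  exact hF.mono fun x hx => Zp_PhiC I hI e x hx

theorem ed_id (I : Fin s → Fin r → Fin n) (hI : ∀ l, StrictMono (I l)) (hrn : r ≤ n) :
    ed (n - r) (fun l j => (I l j : ℕ) - (j : ℕ)) = edim I := by
  have h := ed_comp I hI hrn (fun _ k => k)
  have h0 : edim (fun (_ : Fin s) (k : Fin r) => k) = 0 := by
    simp [edim, dimI]
  rw [h0, sub_zero] at h
  exact h

theorem belkale_core (hrn : r ≤ n) (I : Fin s → Fin r → Fin n) (hI : ∀ l, StrictMono (I l))
    (h0 : 0 ≤ edim I)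
    (h : ∀ (d : ℕ), 1 ≤ d → d < r →
        ∀ J : Fin s → Fin d → Fin r, (∀ l, StrictMono (J l)) → Intersecting J →
          edim J = 0 → edim J ≤ edim (fun l k => I l (J l k))) :
    ∃ (f : Fin s → Fin r → Fin r → ℂ) (g : Fin s → Fin (n - r) → Fin (n - r) → ℂ),
      Frame f ∧ Frame g ∧ Surj (fun l j => (I l j : ℕ) - (j : ℕ)) f g := by
  refine exists_surj_frame r _ (fun l => sm_mono (hI l)) (fun l j => sm_le (hI l) j) ?_
  refine exists_SS (fun l => sm_mono (hI l)) (fun l j => sm_le (hI l) j) ?_ ?_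
  · rw [ed_id I hI hrn]; exact h0
  · intro d hd hdr J hJ hZ hJ0
    have h1 := ed_comp I hI hrn J
    have h2 := h d hd hdr J hJ ((intersecting_iff J).2 hZ) hJ0
    rw [h1]
    linarith

end final

/-- **Belkale's theorem.** For `𝐈 ∈ Subsets(r,n,s)` the following are equivalent:
(1) `𝐈` is intersecting; (2) `edim 𝐈 ≥ 0` and `𝐈` satisfies the Horn inequalities
for `Intersecting(d,r,s)` for all `d ∈ [r-1]`; (3) the same with
`Intersecting⁰(d,r,s)` (intersecting tuples of expected dimension `0`). -/
theorem belkale (s r n : ℕ) (hs : 2 ≤ s) (hr : 1 ≤ r) (hrn : r ≤ n)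
    (I : Fin s → Fin r → Fin n) (hI : ∀ l, StrictMono (I l)) :
    (Intersecting I ↔
      (0 ≤ edim I ∧ ∀ (d : ℕ), 1 ≤ d → d < r →
        ∀ J : Fin s → Fin d → Fin r, (∀ l, StrictMono (J l)) → Intersecting J →
          edim J ≤ edim (fun l k => I l (J l k)))) ∧
    (Intersecting I ↔
      (0 ≤ edim I ∧ ∀ (d : ℕ), 1 ≤ d → d < r →
        ∀ J : Fin s → Fin d → Fin r, (∀ l, StrictMono (J l)) → Intersecting J →
          edim J = 0 → edim J ≤ edim (fun l k => I l (J l k)))) := by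
  have h13 : Intersecting I → (0 ≤ edim I ∧ ∀ (d : ℕ), 1 ≤ d → d < r →
        ∀ J : Fin s → Fin d → Fin r, (∀ l, StrictMono (J l)) → Intersecting J →
          edim J = 0 → edim J ≤ edim (fun l k => I l (J l k))) := by
    intro h
    rw [intersecting_iff] at h
    refine ⟨edim_nonneg_of_generic I h, fun d _ _ J _ hJ hJ0 => ?_⟩
    rw [intersecting_iff] at hJ
    rw [hJ0]
    exact edim_nonneg_of_generic _ (comp_generic I J h hJ)
  have h23 : (0 ≤ edim I ∧ ∀ (d : ℕ), 1 ≤ d → d < r →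
        ∀ J : Fin s → Fin d → Fin r, (∀ l, StrictMono (J l)) → Intersecting J →
          edim J ≤ edim (fun l k => I l (J l k))) →
      (0 ≤ edim I ∧ ∀ (d : ℕ), 1 ≤ d → d < r →
        ∀ J : Fin s → Fin d → Fin r, (∀ l, StrictMono (J l)) → Intersecting J →
          edim J = 0 → edim J ≤ edim (fun l k => I l (J l k))) :=
    fun h => ⟨h.1, fun d h1 h2 J h3 h4 _ => h.2 d h1 h2 J h3 h4⟩
  have h31 : (0 ≤ edim I ∧ ∀ (d : ℕ), 1 ≤ d → d < r →
        ∀ J : Fin s → Fin d → Fin r, (∀ l, StrictMono (J l)) → Intersecting J →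
          edim J = 0 → edim J ≤ edim (fun l k => I l (J l k))) → Intersecting I := by
    intro h
    obtain ⟨f, g, hf, hg, hS⟩ := belkale_core hrn I hI h.1 h.2
    rw [intersecting_iff]
    exact generic_of_Surj I hI (Nat.add_sub_cancel' hrn) hf hg hS
  refine ⟨⟨fun h => ?_, fun h => h31 (h23 h)⟩, h13, h31⟩
  have h3 := h13 h
  refine ⟨h3.1, fun d _ _ J _ hJ => ?_⟩
  obtain ⟨f, g, hf, hg, hS⟩ := belkale_core hrn I hI h3.1 h3.2
  have h1 := ed_nonneg_of_Surj (fun l => sm_mono (hI l)) (fun l j => sm_le (hI l) j) hf hg hS J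
    ((intersecting_iff J).1 hJ f hf)
  rw [ed_comp I hI hrn J] at h1
  linarith
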